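/- Let α > 0 and let Σ ⊆ ℕ be a multiplicative semigroup with liminf_{N→∞} #(Σ ∩ [1,N])/N^α > 0. Let μ be an ergodic Σ-invariant Borel probability measure on 𝕋 = ℝ/ℤ. Then either μ is supported on a finite number of points, or μ is Lebesgue measure. -/

import Mathlib

open MeasureTheory Filter
open scoped ENNReal


abbrev Circ : Type := AddCircle (1:ℝ)

/-- multiplication map -/
def mulT (n : ℕ) (x : Circ) : Circ := n • x

theorem mulT_meas (n : ℕ) : Measurable (mulT n) := by
  have : Continuous (mulT n) := by unfold mulT; fun_prop
  exact this.measurable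

theorem mulT_mulT (a b : ℕ) (x : Circ) : mulT a (mulT b x) = mulT (a * b) x := by
  simp [mulT, mul_smul]

theorem mulT_comp (a b : ℕ) : mulT a ∘ mulT b = mulT (a * b) := by
  funext x; exact mulT_mulT a b x

noncomputable def lft (z : Circ) : ℝ := (AddCircle.equivIco (1:ℝ) 0 z : ℝ)

theorem lft_meas : Measurable lft := by
  have := (AddCircle.measurableEquivIco (1:ℝ) 0).measurable
  exact measurable_subtype_coe.comp this

theorem lft_coe (z : Circ) : ((lft z : ℝ) : Circ) = z := AddCircle.coe_equivIco

theorem lft_nonneg (z : Circ) : 0 ≤ lft z := (AddCircle.equivIco (1:ℝ) 0 z).2.1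
theorem lft_lt (z : Circ) : lft z < 1 := by
  have := (AddCircle.equivIco (1:ℝ) 0 z).2.2
  exact lt_of_lt_of_eq this (zero_add 1)

theorem lft_of (t : ℝ) : lft (t : Circ) = Int.fract t := by
  unfold lft
  rw [AddCircle.coe_equivIco_mk_apply]; simp

theorem coe_eq_iff (s t : ℝ) : (s : Circ) = (t : Circ) ↔ ∃ n : ℤ, s - t = n := by
  rw [← sub_eq_zero, ← AddCircle.coe_sub, AddCircle.coe_eq_zero_iff]
  constructor
  · rintro ⟨n, hn⟩; exact ⟨n, by simpa using hn.symm⟩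
  · rintro ⟨n, hn⟩; exact ⟨n, by simpa using hn.symm⟩

/-- inverse branches -/
noncomputable def br (a j : ℕ) (z : Circ) : Circ := (((lft z + j) / a : ℝ) : Circ)

theorem br_meas (a j : ℕ) : Measurable (br a j) := by
  unfold br
  exact AddCircle.measurable_mk'.comp ((lft_meas.add_const _).div_const _)

theorem mulT_br {a : ℕ} (ha : a ≠ 0) (j : ℕ) (z : Circ) : mulT a (br a j z) = z := by
  have ha' : (a : ℝ) ≠ 0 := by exact_mod_cast ha
  unfold mulT br
  rw [← AddCircle.coe_nsmul]
  conv_rhs => rw [← lft_coe z]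
  rw [coe_eq_iff]
  refine ⟨j, ?_⟩
  simp only [nsmul_eq_mul, Int.cast_natCast]
  field_simp
  ring

theorem exists_br {a : ℕ} (ha : a ≠ 0) (y : Circ) : ∃ j < a, br a j (mulT a y) = y := by
  have ha' : (0 : ℝ) < a := by exact_mod_cast Nat.pos_of_ne_zero ha
  have h0 := lft_nonneg y
  have h1 := lft_lt y
  have hy : mulT a y = ((a * lft y : ℝ) : Circ) := by
    conv_lhs => rw [← lft_coe y]
    unfold mulT
    rw [← AddCircle.coe_nsmul]; simp
  have hfl : 0 ≤ (a : ℝ) * lft y := by positivity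
  refine ⟨⌊(a : ℝ) * lft y⌋₊, ?_, ?_⟩
  · rw [Nat.floor_lt hfl]; nlinarith
  · rw [hy]
    unfold br
    rw [lft_of]
    conv_rhs => rw [← lft_coe y]
    congr 1
    rw [natCast_floor_eq_intCast_floor hfl, Int.fract_add_floor]
    field_simp

theorem br_inj {a : ℕ} (ha : a ≠ 0) (z : Circ) {i j : ℕ} (hi : i < a) (hj : j < a)
    (h : br a i z = br a j z) : i = j := by
  have ha' : (0 : ℝ) < a := by exact_mod_cast Nat.pos_of_ne_zero ha
  unfold br at h
  rw [coe_eq_iff] at h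
  obtain ⟨n, hn⟩ := h
  have : ((i : ℝ) - j) = n * a := by
    field_simp at hn; linarith
  have h2 : (i : ℤ) - j = n * a := by exact_mod_cast this
  have hn0 : n = 0 := by
    by_contra hne
    have : 1 ≤ |n| := Int.one_le_abs hne
    have h3 : |(i : ℤ) - j| = |n| * a := by rw [h2, abs_mul]; simp
    have h4 : |(i : ℤ) - j| < a := by rw [abs_lt]; omega
    nlinarith
  subst hn0
  omega

/-- sum over the fibre -/
noncomputable def fib (a : ℕ) (f : Circ → ℝ≥0∞) (z : Circ) : ℝ≥0∞ :=
  ∑' y : {y : Circ // mulT a y = z}, f y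

theorem fib_eq {a : ℕ} (ha : a ≠ 0) (f : Circ → ℝ≥0∞) (z : Circ) :
    fib a f z = ∑ j ∈ Finset.range a, f (br a j z) := by
  let e : Fin a → {y : Circ // mulT a y = z} := fun j => ⟨br a j z, mulT_br ha j z⟩
  have he : Function.Bijective e := by
    constructor
    · intro i j hij
      have := congrArg Subtype.val hij
      exact Fin.ext (br_inj ha z i.2 j.2 this)
    · rintro ⟨y, rfl⟩
      obtain ⟨j, hj, h⟩ := exists_br ha y
      exact ⟨⟨j, hj⟩, Subtype.ext h⟩
  unfold fib
  rw [← (Equiv.ofBijective e he).tsum_eq (fun y => f y.1), tsum_fintype, Finset.sum_range]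
  rfl

theorem fib_meas {a : ℕ} (ha : a ≠ 0) {f : Circ → ℝ≥0∞} (hf : Measurable f) :
    Measurable (fib a f) := by
  have : fib a f = fun z => ∑ j ∈ Finset.range a, f (br a j z) := by
    funext z; exact fib_eq ha f z
  rw [this]
  exact Finset.measurable_sum _ (fun j _ => hf.comp (br_meas a j))

theorem le_fib (a : ℕ) (f : Circ → ℝ≥0∞) (x : Circ) : f x ≤ fib a f (mulT a x) :=
  ENNReal.le_tsum (f := fun y : {y : Circ // mulT a y = mulT a x} => f y.1) ⟨x, rfl⟩

theorem fib_mul (a b : ℕ) (f : Circ → ℝ≥0∞) (z : Circ) :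
    fib (b * a) f z = fib b (fib a f) z := by
  unfold fib
  rw [← ENNReal.tsum_sigma (fun (y : {y : Circ // mulT b y = z})
    (w : {w : Circ // mulT a w = y.1}) => f w.1)]
  let e : (Σ y : {y : Circ // mulT b y = z}, {w : Circ // mulT a w = y.1}) ≃
      {w : Circ // mulT (b * a) w = z} :=
    { toFun := fun p => ⟨p.2.1, by rw [← mulT_mulT, p.2.2, p.1.2]⟩
      invFun := fun w => ⟨⟨mulT a w.1, by rw [mulT_mulT, w.2]⟩, ⟨w.1, rfl⟩⟩
      left_inv := by
        rintro ⟨⟨y, hy⟩, ⟨w, hw⟩⟩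
        dsimp only at hw
        subst hw
        rfl
      right_inv := by rintro ⟨w, hw⟩; rfl }
  rw [← e.tsum_eq]
  rfl

theorem fib_coprime {a c : ℕ} (h : Nat.Coprime c a) (f : Circ → ℝ≥0∞) (z : Circ) :
    fib a (fun y => f (mulT c y)) z = fib a f (mulT c z) := by
  unfold fib
  have hb : (c : ℤ) * Nat.gcdA c a + a * Nat.gcdB c a = 1 := by
    have := Nat.gcd_eq_gcd_ab c a
    rw [h] at this; simpa using this.symm
  set v := Nat.gcdA c a
  set u := Nat.gcdB c a
  let e : {y : Circ // mulT a y = z} → {y : Circ // mulT a y = mulT c z} :=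
    fun y => ⟨mulT c y.1, by rw [mulT_mulT, mul_comm, ← mulT_mulT, y.2]⟩
  have he : Function.Bijective e := by
    constructor
    · rintro ⟨y, hy⟩ ⟨y', hy'⟩ hh
      have h1 := congrArg Subtype.val hh
      simp only [e, mulT] at h1 hy hy'
      apply Subtype.ext
      change y = y'
      calc y = ((c : ℤ) * v + a * u) • y := by rw [hb, one_zsmul]
        _ = v • (c • y) + u • (a • y) := by
            rw [add_zsmul, mul_comm, mul_zsmul, mul_comm (a : ℤ), mul_zsmul]; simp
        _ = v • (c • y') + u • (a • y') := by rw [h1, hy, hy']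
        _ = ((c : ℤ) * v + a * u) • y' := by
            rw [add_zsmul, mul_comm, mul_zsmul, mul_comm (a : ℤ), mul_zsmul]; simp
        _ = y' := by rw [hb, one_zsmul]
    · rintro ⟨y', hy'⟩
      simp only [mulT] at hy'
      refine ⟨⟨u • z + v • y', ?_⟩, ?_⟩
      · simp only [mulT]
        calc a • (u • z + v • y') = (a * u : ℤ) • z + v • (a • y') := by
              rw [smul_add, mul_zsmul]
              simp only [natCast_zsmul]
              rw [smul_comm a v]
          _ = ((c : ℤ) * v + a * u) • z := by
              rw [hy', add_zsmul, mul_comm (c : ℤ), mul_smul v, natCast_zsmul, add_comm]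
          _ = z := by rw [hb, one_zsmul]
      · apply Subtype.ext
        simp only [e, mulT]
        calc c • (u • z + v • y') = u • (c • z) + (c * v : ℤ) • y' := by
              rw [smul_add, mul_zsmul]
              simp only [natCast_zsmul]
              rw [smul_comm c u]
          _ = ((c : ℤ) * v + a * u) • y' := by
              rw [← hy', add_zsmul, mul_comm (a : ℤ), mul_smul u, natCast_zsmul, add_comm]
          _ = y' := by rw [hb, one_zsmul]
  rw [← (Equiv.ofBijective e he).tsum_eq]
  rfl

/-- pull-back of measures -/
noncomputable def pull (a : ℕ) (ν : Measure Circ) : Measure Circ :=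
  ∑ j ∈ Finset.range a, ν.map (br a j)

instance pull_fin (a : ℕ) (ν : Measure Circ) [IsFiniteMeasure ν] : IsFiniteMeasure (pull a ν) := by
  unfold pull; infer_instance

theorem lintegral_pull {a : ℕ} (ha : a ≠ 0) (ν : Measure Circ) {f : Circ → ℝ≥0∞}
    (hf : Measurable f) : ∫⁻ x, f x ∂(pull a ν) = ∫⁻ z, fib a f z ∂ν := by
  unfold pull
  rw [lintegral_finsetSum_measure]
  simp_rw [fib_eq ha]
  rw [lintegral_finsetSum (f := fun j z => f (br a j z)) _ (fun j _ => hf.comp (br_meas a j))]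
  exact Finset.sum_congr rfl (fun j _ => lintegral_map hf (br_meas a j))

theorem pull_univ {a : ℕ} (ν : Measure Circ) [IsProbabilityMeasure ν] :
    pull a ν Set.univ = a := by
  unfold pull
  rw [Measure.finsetSum_apply]
  simp [Measure.map_apply (br_meas a _) MeasurableSet.univ]

theorem le_pull {a : ℕ} (ha : a ≠ 0) (μ : Measure Circ) : μ ≤ pull a (μ.map (mulT a)) := by
  rw [Measure.le_iff]
  intro A hA
  rw [← lintegral_indicator_one hA, ← lintegral_indicator_one hA]
  have hm : Measurable (A.indicator (1 : Circ → ℝ≥0∞)) := measurable_one.indicator hA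
  rw [lintegral_pull ha _ hm, lintegral_map (fib_meas ha hm) (mulT_meas a)]
  exact lintegral_mono (fun x => le_fib a _ x)

theorem pull_pull {a b : ℕ} (ha : a ≠ 0) (hb : b ≠ 0) (ν : Measure Circ) :
    pull a (pull b ν) = pull (a * b) ν := by
  apply Measure.ext_of_lintegral
  intro f hf
  rw [lintegral_pull ha _ hf, lintegral_pull hb _ (fib_meas ha hf),
    lintegral_pull (mul_ne_zero ha hb) _ hf]
  simp_rw [mul_comm a b, fib_mul]

theorem pull_withDensity {a : ℕ} (ha : a ≠ 0) (ν : Measure Circ) {g : Circ → ℝ≥0∞}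
    (hg : Measurable g) :
    pull a (ν.withDensity g) = (pull a ν).withDensity (fun x => g (mulT a x)) := by
  apply Measure.ext_of_lintegral
  intro f hf
  have hg' : Measurable (fun x => g (mulT a x)) := hg.comp (mulT_meas a)
  rw [lintegral_pull ha _ hf, lintegral_withDensity_eq_lintegral_mul _ hg (fib_meas ha hf),
    lintegral_withDensity_eq_lintegral_mul _ hg' hf, lintegral_pull ha _ (hg'.mul hf)]
  congr 1
  funext z
  simp only [Pi.mul_apply]
  unfold fib
  rw [← ENNReal.tsum_mul_left]
  congr 1
  funext y
  rw [Pi.mul_apply, y.2]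

theorem map_pull_coprime {a c : ℕ} (ha : a ≠ 0) (h : Nat.Coprime c a) (ν : Measure Circ) :
    (pull a ν).map (mulT c) = pull a (ν.map (mulT c)) := by
  apply Measure.ext_of_lintegral
  intro f hf
  rw [lintegral_map hf (mulT_meas c), lintegral_pull (f := fun x => f (mulT c x)) ha _ (hf.comp (mulT_meas c)),
    lintegral_pull ha _ hf, lintegral_map (fib_meas ha hf) (mulT_meas c)]
  simp_rw [← fib_coprime h]

/-- The conditional probability of `x` given `a x`. -/
noncomputable def phi (a : ℕ) (μ : Measure Circ) : Circ → ℝ≥0∞ :=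
  μ.rnDeriv (pull a (μ.map (mulT a)))

theorem phi_meas (a : ℕ) (μ : Measure Circ) : Measurable (phi a μ) :=
  Measure.measurable_rnDeriv _ _

theorem ac_pull {a : ℕ} (ha : a ≠ 0) (μ : Measure Circ) : μ ≪ pull a (μ.map (mulT a)) :=
  Measure.absolutelyContinuous_of_le (le_pull ha μ)

section
variable (μ : Measure Circ) [IsFiniteMeasure μ]

instance pull_hld (a : ℕ) : μ.HaveLebesgueDecomposition (pull a (μ.map (mulT a))) := by
  have : SigmaFinite (pull a (μ.map (mulT a))) := inferInstance
  exact Measure.haveLebesgueDecomposition_of_sigmaFinite _ _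

theorem phi_density {a : ℕ} (ha : a ≠ 0) :
    (pull a (μ.map (mulT a))).withDensity (phi a μ) = μ :=
  Measure.withDensity_rnDeriv_eq _ _ (ac_pull ha μ)

theorem phi_le_one {a : ℕ} (ha : a ≠ 0) : ∀ᵐ x ∂μ, phi a μ x ≤ 1 :=
  (ac_pull ha μ).ae_le (Measure.rnDeriv_le_one_of_le (le_pull ha μ))

theorem phi_pos {a : ℕ} (ha : a ≠ 0) : ∀ᵐ x ∂μ, 0 < phi a μ x :=
  Measure.rnDeriv_pos (ac_pull ha μ)

theorem phi_chain {a b : ℕ} (ha : a ≠ 0) (hb : b ≠ 0) :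
    ∀ᵐ x ∂μ, phi (a * b) μ x = phi a μ x * phi b (μ.map (mulT a)) (mulT a x) := by
  have hab := mul_ne_zero ha hb
  have e1 : pull (a * b) (μ.map (mulT (a * b))) =
      pull a (pull b ((μ.map (mulT a)).map (mulT b))) := by
    rw [pull_pull ha hb, Measure.map_map (mulT_meas b) (mulT_meas a), mulT_comp, mul_comm b a]
  have hm1 : Measurable (fun x => phi b (μ.map (mulT a)) (mulT a x)) :=
    (phi_meas b _).comp (mulT_meas a)
  have e2 : (pull (a * b) (μ.map (mulT (a * b)))).withDensity
      ((fun x => phi b (μ.map (mulT a)) (mulT a x)) * phi a μ) = μ := by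
    rw [withDensity_mul _ hm1 (phi_meas a μ), e1, ← pull_withDensity ha _ (phi_meas b _),
      phi_density _ hb, phi_density _ ha]
  have e3 := Measure.eq_rnDeriv (μ := μ) (ν := pull (a * b) (μ.map (mulT (a * b)))) (s := 0)
    (hm1.mul (phi_meas a μ)) (Measure.MutuallySingular.zero_left) (by rw [zero_add]; exact e2.symm)
  filter_upwards [(ac_pull hab μ).ae_le e3] with x hx
  rw [phi, ← hx]
  simp [mul_comm]

/-- lintegral of `g` against `μ` versus pulled-back measure -/
theorem lintegral_phi_mul {a : ℕ} (ha : a ≠ 0) {g : Circ → ℝ≥0∞} (hg : Measurable g) :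
    ∫⁻ x, phi a μ x * g x ∂(pull a (μ.map (mulT a))) = ∫⁻ x, g x ∂μ :=
  lintegral_rnDeriv_mul (ac_pull ha μ) hg.aemeasurable

theorem lintegral_div_phi {a : ℕ} (ha : a ≠ 0) {g : Circ → ℝ≥0∞} (hg : Measurable g) :
    ∫⁻ x, g x / phi a μ x ∂μ ≤ ∫⁻ x, g x ∂(pull a (μ.map (mulT a))) := by
  rw [← lintegral_phi_mul (g := fun x => g x / phi a μ x) μ ha (hg.div (phi_meas a μ))]
  apply lintegral_mono_ae
  filter_upwards with x
  exact ENNReal.mul_div_le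

end


theorem map_prob (μ : Measure Circ) [IsProbabilityMeasure μ] (n : ℕ) :
    IsProbabilityMeasure (μ.map (mulT n)) :=
  Measure.isProbabilityMeasure_map (mulT_meas n).aemeasurable

theorem ae_map_mulT {μ : Measure Circ} {n : ℕ} {q : Circ → Prop}
    (h : ∀ᵐ y ∂(μ.map (mulT n)), q y) : ∀ᵐ x ∂μ, q (mulT n x) :=
  ae_of_ae_map (mulT_meas n).aemeasurable h

theorem lphi_integrable (μ : Measure Circ) [IsProbabilityMeasure μ] {a : ℕ} (ha : a ≠ 0) :
    Integrable (fun x => Real.log (phi a μ x).toReal) μ := by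
  have := map_prob μ a
  have h1 : ∫⁻ x, 1 / phi a μ x ∂μ ≠ ∞ := by
    refine ne_top_of_le_ne_top ?_ (lintegral_div_phi (g := fun _ => 1) μ ha measurable_const)
    rw [lintegral_one, pull_univ]; simp
  have hm : Measurable (fun x => 1 / phi a μ x) := measurable_const.div (phi_meas a μ)
  have h2 : Integrable (fun x => (1 / phi a μ x).toReal) μ :=
    integrable_toReal_of_lintegral_ne_top hm.aemeasurable h1
  refine h2.mono' (Real.measurable_log.comp (phi_meas a μ).ennreal_toReal).aestronglyMeasurable ?_
  filter_upwards [phi_pos μ ha, phi_le_one μ ha] with x hx0 hx1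
  have ht : 0 < (phi a μ x).toReal :=
    ENNReal.toReal_pos hx0.ne' (ne_top_of_le_ne_top ENNReal.one_ne_top hx1)
  have ht1 : (phi a μ x).toReal ≤ 1 := ENNReal.toReal_le_of_le_ofReal zero_le_one (by simpa using hx1)
  rw [Real.norm_eq_abs, abs_of_nonpos (Real.log_nonpos ht.le ht1), ENNReal.toReal_div,
    ← Real.log_inv]
  have := Real.log_le_sub_one_of_pos (inv_pos.mpr ht)
  simp only [ENNReal.toReal_one, one_div]
  linarith

theorem phi_toReal_pos (μ : Measure Circ) [IsProbabilityMeasure μ] {a : ℕ} (ha : a ≠ 0) :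
    ∀ᵐ x ∂μ, 0 < (phi a μ x).toReal := by
  filter_upwards [phi_pos μ ha, phi_le_one μ ha] with x hx0 hx1
  exact ENNReal.toReal_pos hx0.ne' (ne_top_of_le_ne_top ENNReal.one_ne_top hx1)

theorem lphi_integral_eq (μ : Measure Circ) [IsProbabilityMeasure μ] {a Q : ℕ} (ha : a ≠ 0)
    (hQ : Q ≠ 0) (hμa : μ.map (mulT a) = μ) :
    ∫ y, Real.log (phi a (μ.map (mulT Q)) y).toReal ∂(μ.map (mulT Q)) =
      ∫ x, Real.log (phi a μ x).toReal ∂μ := by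
  have hp := map_prob μ Q
  have hmν : Measurable (fun y => Real.log (phi a (μ.map (mulT Q)) y).toReal) :=
    Real.measurable_log.comp (phi_meas a _).ennreal_toReal
  have hmR : Measurable (fun y => Real.log (phi Q μ y).toReal) :=
    Real.measurable_log.comp (phi_meas Q _).ennreal_toReal
  have iR := lphi_integrable μ hQ
  have iA := lphi_integrable μ ha
  have iB := lphi_integrable (μ.map (mulT Q)) ha
  have iB' : Integrable (fun x => Real.log (phi a (μ.map (mulT Q)) (mulT Q x)).toReal) μ :=
    iB.comp_measurable (mulT_meas Q)
  have iR' : Integrable (fun x => Real.log (phi Q μ (mulT a x)).toReal) μ := by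
    have := iR
    rw [← hμa] at this
    have h := this.comp_measurable (mulT_meas a)
    rw [hμa] at h
    exact h
  have eR' : ∫ x, Real.log (phi Q μ (mulT a x)).toReal ∂μ = ∫ x, Real.log (phi Q μ x).toReal ∂μ := by
    have := integral_map (μ := μ) (mulT_meas a).aemeasurable
      (hmR.aestronglyMeasurable (μ := μ.map (mulT a)))
    rw [← this, hμa]
  rw [integral_map (mulT_meas Q).aemeasurable hmν.aestronglyMeasurable]
  have key : ∀ᵐ x ∂μ, Real.log (phi Q μ x).toReal + Real.log (phi a (μ.map (mulT Q)) (mulT Q x)).toReal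
      = Real.log (phi a μ x).toReal + Real.log (phi Q μ (mulT a x)).toReal := by
    have c1 := phi_chain μ hQ ha
    have c2 := phi_chain μ ha hQ
    rw [hμa] at c2
    have p3 : ∀ᵐ x ∂μ, 0 < (phi Q μ (mulT a x)).toReal := by
      have := phi_toReal_pos μ hQ
      rw [← hμa] at this
      have h := ae_map_mulT this
      rw [hμa] at h
      exact h
    filter_upwards [c1, c2, phi_toReal_pos μ hQ, phi_toReal_pos μ ha, p3,
      ae_map_mulT (phi_toReal_pos (μ.map (mulT Q)) ha)] with x h1 h2 h3 h4 h5 h6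
    rw [← Real.log_mul h3.ne' h6.ne', ← Real.log_mul h4.ne' h5.ne', ← ENNReal.toReal_mul,
      ← ENNReal.toReal_mul, ← h1, ← h2, mul_comm]
  have := integral_congr_ae key
  rw [integral_add iR iB', integral_add iA iR', eR'] at this
  linarith

theorem phi_rigid (μ : Measure Circ) [IsProbabilityMeasure μ] {a Q c : ℕ} (ha : a ≠ 0)
    (hQ : Q ≠ 0) (hc : Nat.Coprime c a) (hμa : μ.map (mulT a) = μ)
    (hμc : μ.map (mulT (c * Q)) = μ) :
    ∀ᵐ y ∂(μ.map (mulT Q)), phi a (μ.map (mulT Q)) y = phi a μ (mulT c y) := by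
  have hInts := lphi_integral_eq μ ha hQ hμa
  have hp := map_prob μ Q
  set ν := μ.map (mulT Q) with hν
  have hνc : ν.map (mulT c) = μ := by
    rw [hν, Measure.map_map (mulT_meas c) (mulT_meas Q), mulT_comp, hμc]
  have hm1 : Measurable (fun y => phi a μ (mulT c y)) := (phi_meas a μ).comp (mulT_meas c)
  have l1 : ∫⁻ y, phi a μ (mulT c y) / phi a ν y ∂ν ≤ 1 := by
    refine (lintegral_div_phi ν ha hm1).trans ?_
    rw [← lintegral_map (phi_meas a μ) (mulT_meas c), map_pull_coprime ha hc,
      Measure.map_map (mulT_meas c) (mulT_meas a), mulT_comp, mul_comm, ← mulT_comp,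
      ← Measure.map_map (mulT_meas a) (mulT_meas c), hνc]
    have := lintegral_phi_mul (g := fun _ => 1) μ ha measurable_const
    simp only [mul_one, lintegral_one, measure_univ] at this
    exact this.le
  have hmt : Measurable (fun y => phi a μ (mulT c y) / phi a ν y) := hm1.div (phi_meas a ν)
  have it : Integrable (fun y => (phi a μ (mulT c y) / phi a ν y).toReal) ν :=
    integrable_toReal_of_lintegral_ne_top hmt.aemeasurable (ne_top_of_le_ne_top ENNReal.one_ne_top l1)
  have hpos1 : ∀ᵐ y ∂ν, 0 < (phi a μ (mulT c y)).toReal := by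
    have := phi_toReal_pos μ ha
    rw [← hνc] at this
    have h := ae_map_mulT this
    rw [hνc] at h
    exact h
  have hpos2 := phi_toReal_pos ν ha
  have hfin : ∀ᵐ y ∂ν, phi a μ (mulT c y) / phi a ν y < ∞ :=
    ae_lt_top hmt (ne_top_of_le_ne_top ENNReal.one_ne_top l1)
  have et : ∫ y, (phi a μ (mulT c y) / phi a ν y).toReal ∂ν ≤ 1 := by
    rw [integral_toReal hmt.aemeasurable hfin]
    exact ENNReal.toReal_le_of_le_ofReal zero_le_one (by simpa using l1)
  have i1 : Integrable (fun y => Real.log (phi a μ (mulT c y)).toReal) ν := by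
    have := lphi_integrable μ ha
    rw [← hνc] at this
    have h := this.comp_measurable (mulT_meas c)
    rw [hνc] at h
    exact h
  have e1 : ∫ y, Real.log (phi a μ (mulT c y)).toReal ∂ν = ∫ x, Real.log (phi a μ x).toReal ∂μ := by
    have hmR : Measurable (fun y => Real.log (phi a μ y).toReal) :=
      Real.measurable_log.comp (phi_meas a _).ennreal_toReal
    have := integral_map (μ := ν) (mulT_meas c).aemeasurable
      (hmR.aestronglyMeasurable (μ := ν.map (mulT c)))
    rw [← this, hνc]
  have i2 := lphi_integrable ν ha
  have nonneg : ∀ᵐ y ∂ν, 0 ≤ (phi a μ (mulT c y) / phi a ν y).toReal - 1 -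
      (Real.log (phi a μ (mulT c y)).toReal - Real.log (phi a ν y).toReal) := by
    filter_upwards [hpos1, hpos2] with y h1 h2
    rw [← Real.log_div h1.ne' h2.ne', ENNReal.toReal_div]
    have := Real.log_le_sub_one_of_pos (div_pos h1 h2)
    linarith
  have hI : Integrable (fun y => (phi a μ (mulT c y) / phi a ν y).toReal - 1 -
      (Real.log (phi a μ (mulT c y)).toReal - Real.log (phi a ν y).toReal)) ν :=
    (it.sub (integrable_const 1)).sub (i1.sub i2)
  have hzero : ∫ y, ((phi a μ (mulT c y) / phi a ν y).toReal - 1 -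
      (Real.log (phi a μ (mulT c y)).toReal - Real.log (phi a ν y).toReal)) ∂ν = 0 := by
    apply le_antisymm _ (integral_nonneg_of_ae nonneg)
    have j1 : Integrable (fun y => (phi a μ (mulT c y) / phi a ν y).toReal - 1) ν :=
      it.sub (integrable_const 1)
    have j2 : Integrable (fun y => Real.log (phi a μ (mulT c y)).toReal -
      Real.log (phi a ν y).toReal) ν := i1.sub i2
    rw [integral_sub j1 j2, integral_sub it (integrable_const 1),
      integral_sub i1 i2, e1, hInts]
    rw [integral_const, probReal_univ, smul_eq_mul]
    linarith
  have hae := (integral_eq_zero_iff_of_nonneg_ae nonneg hI).mp hzero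
  filter_upwards [hae, hpos1, hpos2] with y h0 h1 h2
  simp only [Pi.zero_apply] at h0
  rw [← Real.log_div h1.ne' h2.ne', ENNReal.toReal_div] at h0
  have ht : (phi a μ (mulT c y)).toReal / (phi a ν y).toReal = 1 := by
    by_contra hne
    have := Real.log_lt_sub_one_of_pos (div_pos h1 h2) hne
    linarith
  rw [div_eq_one_iff_eq h2.ne'] at ht
  have n1 : phi a μ (mulT c y) ≠ ∞ := fun h => by simp [h] at h1
  have n2 : phi a ν y ≠ ∞ := fun h => by simp [h] at h2
  exact ((ENNReal.toReal_eq_toReal_iff' n1 n2).mp ht).symm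


theorem fourier_mulT (n : ℤ) (Q : ℕ) (x : Circ) :
    (fourier n (mulT Q x) : ℂ) = fourier (n * Q) x := by
  simp only [fourier_apply, mulT]
  congr 2
  rw [mul_smul, natCast_zsmul]

theorem sum_fourier_br {a : ℕ} (ha : a ≠ 0) (n : ℤ) (hn : ¬ (a : ℤ) ∣ n) (z : Circ) :
    ∑ j ∈ Finset.range a, (fourier n (br a j z) : ℂ) = 0 := by
  have ha' : (a : ℂ) ≠ 0 := by exact_mod_cast ha
  set ζ : ℂ := Complex.exp (2 * Real.pi * Complex.I * n / a) with hζ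
  have h1 : ∀ j : ℕ, (fourier n (br a j z) : ℂ) =
      Complex.exp (2 * Real.pi * Complex.I * n * lft z / a) * ζ ^ j := by
    intro j
    rw [hζ, ← Complex.exp_nat_mul, ← Complex.exp_add]
    unfold br
    rw [fourier_coe_apply]
    congr 1
    push_cast
    field_simp
  simp_rw [h1, ← Finset.mul_sum]
  have hz1 : ζ ≠ 1 := by
    intro h
    rw [hζ, Complex.exp_eq_one_iff] at h
    obtain ⟨m, hm⟩ := h
    apply hn
    refine ⟨m, ?_⟩
    have hpi : (2 * Real.pi * Complex.I : ℂ) ≠ 0 := Complex.two_pi_I_ne_zero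
    have : (n : ℂ) = a * m := by
      field_simp at hm
      have h3 : (2 * Real.pi * Complex.I : ℂ) * n = (2 * Real.pi * Complex.I : ℂ) * (a * m) := by
        linear_combination (2 * Real.pi * Complex.I : ℂ) * hm
      exact mul_left_cancel₀ hpi h3
    exact_mod_cast this
  have hza : ζ ^ a = 1 := by
    rw [hζ, ← Complex.exp_nat_mul, Complex.exp_eq_one_iff]
    exact ⟨n, by field_simp⟩
  rw [geom_sum_eq hz1, hza]; simp

/-- the average of characters -/
noncomputable def avgf (L : ℕ) (m : ℕ → ℤ) (y : Circ) : ℂ :=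
  (L : ℂ)⁻¹ * ∑ i ∈ Finset.range L, (fourier (m i) y : ℂ)

theorem avgf_cont (L : ℕ) (m : ℕ → ℤ) : Continuous (avgf L m) := by
  unfold avgf; fun_prop

theorem norm_fourier_apply (n : ℤ) (y : Circ) : ‖(fourier n y : ℂ)‖ = 1 := by
  rw [fourier_apply]; exact Circle.norm_coe _

theorem avgf_le (L : ℕ) (m : ℕ → ℤ) (y : Circ) : ‖avgf L m y‖ ≤ 1 := by
  unfold avgf
  rw [norm_mul, norm_inv, Complex.norm_natCast]
  rcases Nat.eq_zero_or_pos L with h | h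
  · subst h; simp
  have h2 : ‖∑ i ∈ Finset.range L, (fourier (m i) y : ℂ)‖ ≤ L := by
    refine (norm_sum_le _ _).trans ?_
    simp only [norm_fourier_apply, Finset.sum_const, Finset.card_range, nsmul_eq_mul, mul_one,
      le_refl]
  have : (0 : ℝ) < L := by exact_mod_cast h
  rw [inv_mul_le_iff₀ this]; simpa using h2

def pairs (a L : ℕ) (m : ℕ → ℤ) : Finset (ℕ × ℕ) :=
  ((Finset.range L) ×ˢ (Finset.range L)).filter (fun p => (a : ℤ) ∣ m p.1 - m p.2)

theorem fourier_mul_conj (m n : ℤ) (y : Circ) :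
    (fourier m y : ℂ) * (starRingEnd ℂ) (fourier n y : ℂ) = fourier (m - n) y := by
  rw [← fourier_neg, ← fourier_add, sub_eq_add_neg]

theorem sum_avgf {a : ℕ} (ha : a ≠ 0) (L : ℕ) (m : ℕ → ℤ) (z : Circ) :
    ∑ j ∈ Finset.range a, ‖avgf L m (br a j z)‖ ^ 2 ≤ a * (pairs a L m).card / (L : ℝ) ^ 2 := by
  have h1 : ∀ y, ((‖avgf L m y‖ ^ 2 : ℝ) : ℂ) = ((L : ℂ) ^ 2)⁻¹ *
      ∑ p ∈ (Finset.range L) ×ˢ (Finset.range L), (fourier (m p.1 - m p.2) y : ℂ) := by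
    intro y
    have : ((‖avgf L m y‖ ^ 2 : ℝ) : ℂ) = avgf L m y * (starRingEnd ℂ) (avgf L m y) := by
      rw [Complex.mul_conj']; push_cast; rfl
    rw [this]
    unfold avgf
    rw [map_mul, map_sum, map_inv₀, Complex.conj_natCast, Finset.sum_product]
    simp_rw [← fourier_mul_conj]
    rw [mul_mul_mul_comm, Finset.sum_mul_sum]
    congr 1
    rw [sq, mul_inv]
  have h2 : ((∑ j ∈ Finset.range a, ‖avgf L m (br a j z)‖ ^ 2 : ℝ) : ℂ) = ((L : ℂ) ^ 2)⁻¹ *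
      ∑ p ∈ pairs a L m, ∑ j ∈ Finset.range a, (fourier (m p.1 - m p.2) (br a j z) : ℂ) := by
    rw [Complex.ofReal_sum]
    simp_rw [h1]
    rw [← Finset.mul_sum, Finset.sum_comm]
    congr 1
    unfold pairs
    rw [Finset.sum_filter]
    apply Finset.sum_congr rfl
    intro p _
    split_ifs with h
    · rfl
    · exact sum_fourier_br ha _ h z
  have h3 : ‖((∑ j ∈ Finset.range a, ‖avgf L m (br a j z)‖ ^ 2 : ℝ) : ℂ)‖ ≤
      a * (pairs a L m).card / (L : ℝ) ^ 2 := by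
    rw [h2, norm_mul, norm_inv, norm_pow, Complex.norm_natCast, div_eq_inv_mul]
    refine mul_le_mul_of_nonneg_left ?_ (by positivity)
    refine (norm_sum_le _ _).trans ?_
    have : ∀ p ∈ pairs a L m, ‖∑ j ∈ Finset.range a, (fourier (m p.1 - m p.2) (br a j z) : ℂ)‖ ≤ a := by
      intro p _
      refine (norm_sum_le _ _).trans ?_
      simp only [norm_fourier_apply, Finset.sum_const, Finset.card_range, nsmul_eq_mul, mul_one,
        le_refl]
    refine (Finset.sum_le_card_nsmul _ _ _ this).trans ?_
    rw [nsmul_eq_mul, mul_comm]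
  rw [Complex.norm_real] at h3
  exact (le_abs_self _).trans h3

theorem fib_avgf {a : ℕ} (ha : a ≠ 0) (L : ℕ) (m : ℕ → ℤ) (z : Circ) :
    fib a (fun y => ENNReal.ofReal (‖avgf L m y‖ ^ 2)) z ≤
      ENNReal.ofReal (a * (pairs a L m).card / (L : ℝ) ^ 2) := by
  rw [fib_eq ha, ← ENNReal.ofReal_sum_of_nonneg (fun _ _ => by positivity)]
  exact ENNReal.ofReal_le_ofReal (sum_avgf ha L m z)

theorem sq_integral_le (ν : Measure Circ) [IsProbabilityMeasure ν] (f : Circ → ℂ)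
    (hf : Continuous f) : ENNReal.ofReal (‖∫ y, f y ∂ν‖ ^ 2) ≤ ∫⁻ y, ENNReal.ofReal (‖f y‖ ^ 2) ∂ν := by
  have h1 : ‖∫ y, f y ∂ν‖ₑ ≤ eLpNorm f 1 ν := by
    rw [eLpNorm_one_eq_lintegral_enorm]; exact enorm_integral_le_lintegral_enorm f
  have h2 : eLpNorm f 1 ν ≤ eLpNorm f 2 ν :=
    eLpNorm_le_eLpNorm_of_exponent_le (by norm_num) hf.aestronglyMeasurable
  have h3 : eLpNorm f 2 ν ^ 2 = ∫⁻ y, ENNReal.ofReal (‖f y‖ ^ 2) ∂ν := by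
    have := eLpNorm_nnreal_pow_eq_lintegral (μ := ν) (f := f) (p := 2) (by norm_num)
    simp only [NNReal.coe_ofNat, ENNReal.rpow_ofNat, ENNReal.coe_ofNat] at this
    rw [this]
    congr 1; funext y
    rw [ENNReal.ofReal_pow (norm_nonneg _), ofReal_norm]
  rw [ENNReal.ofReal_pow (norm_nonneg _), ofReal_norm, ← h3]
  exact pow_le_pow_left₀ (zero_le) (h1.trans h2) 2

theorem host (μ : Measure Circ) [IsProbabilityMeasure μ] {a Q c L : ℕ} (ha : a ≠ 0)
    (hQ : Q ≠ 0) (hL : L ≠ 0) (hc : Nat.Coprime c a) (hμa : μ.map (mulT a) = μ)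
    (hμc : μ.map (mulT (c * Q)) = μ) (k : ℤ) (m : ℕ → ℤ)
    (hm : ∀ i < L, ∫ x, (fourier (m i * Q) x : ℂ) ∂μ = ∫ x, (fourier k x : ℂ) ∂μ) (ε : ℝ≥0∞) :
    ENNReal.ofReal (‖∫ x, (fourier k x : ℂ) ∂μ‖ ^ 2) ≤ μ {x | ε < phi a μ x} +
      ε * ENNReal.ofReal (a * (pairs a L m).card / (L : ℝ) ^ 2) := by
  have hrig := phi_rigid μ ha hQ hc hμa hμc
  have hp := map_prob μ Q
  set ν := μ.map (mulT Q) with hν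
  have hνc : ν.map (mulT c) = μ := by
    rw [hν, Measure.map_map (mulT_meas c) (mulT_meas Q), mulT_comp, hμc]
  have e1 : ∫ y, avgf L m y ∂ν = ∫ x, (fourier k x : ℂ) ∂μ := by
    rw [hν, integral_map (mulT_meas Q).aemeasurable (avgf_cont L m).aestronglyMeasurable]
    unfold avgf
    rw [integral_const_mul, integral_finsetSum]
    · simp_rw [fourier_mulT]
      rw [Finset.sum_congr rfl (fun i hi => hm i (Finset.mem_range.mp hi))]
      simp only [Finset.sum_const, Finset.card_range, nsmul_eq_mul]
      rw [← mul_assoc, inv_mul_cancel₀ (by exact_mod_cast hL), one_mul]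
    · intro i _
      simp_rw [fourier_mulT]
      refine Integrable.of_bound (C := 1) (by fun_prop) ?_
      filter_upwards with x
      rw [norm_fourier_apply]
  rw [← e1]
  refine (sq_integral_le ν _ (avgf_cont L m)).trans ?_
  set g : Circ → ℝ≥0∞ := fun y => ENNReal.ofReal (‖avgf L m y‖ ^ 2) with hg
  have hgm : Measurable g := by
    have := avgf_cont L m
    exact (Continuous.measurable (by fun_prop)).ennreal_ofReal
  have hg1 : ∀ y, g y ≤ 1 := by
    intro y
    rw [hg]; simp only
    rw [← ENNReal.ofReal_one]
    exact ENNReal.ofReal_le_ofReal (pow_le_one₀ (norm_nonneg _) (avgf_le L m y))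
  have hB : MeasurableSet {y | ε < phi a ν y} := measurableSet_lt measurable_const (phi_meas a ν)
  have hBμ : MeasurableSet {y | ε < phi a μ y} := measurableSet_lt measurable_const (phi_meas a μ)
  have split : ∫⁻ y, g y ∂ν ≤ ∫⁻ y, ({y | ε < phi a ν y}.indicator 1 y +
      {y | ε < phi a ν y}ᶜ.indicator g y) ∂ν := by
    apply lintegral_mono
    intro y
    by_cases hy : y ∈ {y | ε < phi a ν y}
    · simp only [Set.indicator_of_mem hy, Pi.one_apply]
      exact le_add_right (hg1 y)
    · beta_reduce
      rw [Set.indicator_of_notMem hy, Set.indicator_of_mem (show y ∈ {y | ε < phi a ν y}ᶜ from hy),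
        zero_add]
  refine split.trans ?_
  rw [lintegral_add_left (measurable_one.indicator hB), lintegral_indicator_one hB]
  have hfirst : ν {y | ε < phi a ν y} = μ {x | ε < phi a μ x} := by
    conv_rhs => rw [← hνc]
    rw [Measure.map_apply (mulT_meas c) (by rw [hνc]; exact hBμ)]
    rw [hνc]
    apply measure_congr
    filter_upwards [hrig] with y hy
    change (ε < phi a ν y) = (ε < phi a μ (mulT c y))
    rw [hy]
  rw [hfirst]
  gcongr
  have hgi : Measurable ({y | ε < phi a ν y}ᶜ.indicator g) := hgm.indicator hB.compl
  rw [← lintegral_phi_mul ν ha hgi]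
  calc ∫⁻ x, phi a ν x * ({y | ε < phi a ν y}ᶜ.indicator g) x ∂(pull a (ν.map (mulT a)))
      ≤ ∫⁻ x, ε * g x ∂(pull a (ν.map (mulT a))) := by
        apply lintegral_mono
        intro y
        by_cases hy : y ∈ {y | ε < phi a ν y}ᶜ
        · beta_reduce
          rw [Set.indicator_of_mem hy]
          have : phi a ν y ≤ ε := not_lt.mp hy
          exact mul_le_mul' this le_rfl
        · beta_reduce
          rw [Set.indicator_of_notMem hy, mul_zero]; exact zero_le
    _ = ε * ∫⁻ x, g x ∂(pull a (ν.map (mulT a))) := lintegral_const_mul _ hgm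
    _ ≤ _ := by
        gcongr
        rw [lintegral_pull ha _ hgm]
        have := map_prob ν a
        calc ∫⁻ z, fib a g z ∂(ν.map (mulT a)) ≤
            ∫⁻ z, ENNReal.ofReal (a * (pairs a L m).card / (L : ℝ) ^ 2) ∂(ν.map (mulT a)) :=
              lintegral_mono (fun z => fib_avgf ha L m z)
          _ = _ := by simp


theorem lte_aux {p : ℕ} (hp : p ≠ 0) {X Y : ℕ} (hXY : X ≠ Y)
    (hX : Nat.Coprime X p) (hY : Nat.Coprime Y p) {k : ℤ} (hk : k ≠ 0) :
    ∃ C : ℕ, C ≠ 0 ∧ ∀ n d : ℕ, ((p : ℤ) ^ n) ∣ k * ((X : ℤ) ^ d - (Y : ℤ) ^ d) →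
      ((p : ℤ) ^ n) ∣ (C : ℤ) * d := by
  set D := Nat.totient (p ^ 2) with hD
  have hD0 : D ≠ 0 := (Nat.totient_pos.mpr (by positivity)).ne'
  set x : ℤ := (X : ℤ) ^ D with hx
  set y : ℤ := (Y : ℤ) ^ D with hy
  have hxy : x - y ≠ 0 := by
    rw [sub_ne_zero]
    intro h
    have : X ^ D = Y ^ D := by
      rw [hx, hy] at h
      exact_mod_cast h
    exact hXY (Nat.pow_left_injective hD0 this)
  have hmod : ((p ^ 2 : ℕ) : ℤ) ∣ x - y := by
    have h1 := Nat.ModEq.pow_totient (Nat.Coprime.pow_right 2 hX)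
    have h2 := Nat.ModEq.pow_totient (Nat.Coprime.pow_right 2 hY)
    have h3 := (h2.trans h1.symm)
    have := (Nat.modEq_iff_dvd.mp h3)
    push_cast at this ⊢
    exact this
  refine ⟨(k * (x - y)).natAbs, by simpa using ⟨hk, hxy⟩, ?_⟩
  intro n d h
  rcases Nat.eq_zero_or_pos d with hd0 | hd0
  · subst hd0; simp
  have h1 : ((p : ℤ) ^ n) ∣ k * (x ^ d - y ^ d) := by
    refine h.trans (mul_dvd_mul_left k ?_)
    rw [hx, hy, ← pow_mul, ← pow_mul, mul_comm D d, pow_mul, pow_mul]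
    exact sub_dvd_pow_sub_pow _ _ _
  have h2 : ((p : ℤ) ^ n) ∣ k * (x - y) * d := by
    rw [← Int.natAbs_dvd_natAbs, Nat.dvd_iff_prime_pow_dvd_dvd]
    intro r e hr hre
    have hre' : ((r : ℤ) ^ e) ∣ (p : ℤ) ^ n := by
      rw [← Int.natAbs_dvd_natAbs]; simpa [Int.natAbs_pow] using hre
    suffices hs : ((r : ℤ) ^ e) ∣ k * (x - y) * d by
      rw [← Int.natAbs_dvd_natAbs] at hs; simpa [Int.natAbs_pow] using hs
    rcases Nat.eq_zero_or_pos e with he | he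
    · subst he; simp
    have hrp : r ∣ p := by
      have : (r : ℤ) ∣ (p : ℤ) ^ n := (dvd_pow_self _ he.ne').trans hre'
      exact hr.dvd_of_dvd_pow (by exact_mod_cast this)
    have hrx : ¬ (r : ℤ) ∣ x := by
      intro hh
      have h3 : r ∣ X ^ D := by rw [hx] at hh; exact_mod_cast hh
      have h4 := hr.dvd_of_dvd_pow h3
      have h5 : r ∣ Nat.gcd X p := Nat.dvd_gcd h4 hrp
      rw [hX] at h5
      exact hr.one_lt.ne' (Nat.dvd_one.mp h5)
    have hrpZ : Prime (r : ℤ) := Nat.prime_iff_prime_int.mp hr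
    have h3 : ((r : ℤ) ^ e) ∣ k * (x ^ d - y ^ d) := hre'.trans h1
    have hem : emultiplicity (r : ℤ) (x ^ d - y ^ d) =
        emultiplicity (r : ℤ) (x - y) + emultiplicity (r : ℤ) (d : ℤ) := by
      have hr2 : ((r : ℤ) ^ 2) ∣ x - y := by
        refine dvd_trans ?_ hmod
        exact_mod_cast pow_dvd_pow_of_dvd hrp 2
      rcases hr.eq_two_or_odd' with h2 | hodd
      · subst h2
        have := Int.two_pow_sub_pow' (x := x) (y := y) d (by simpa using hr2) hrx
        simpa using this
      · rw [Int.emultiplicity_pow_sub_pow hr hodd ((dvd_pow_self _ two_ne_zero).trans hr2) hrx,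
          Int.natCast_emultiplicity]
    rw [pow_dvd_iff_le_emultiplicity, emultiplicity_mul hrpZ] at h3 ⊢
    rw [emultiplicity_mul hrpZ, add_assoc, ← hem]
    exact h3
  rw [← Int.natAbs_dvd_natAbs] at h2 ⊢
  rw [Int.natAbs_mul _ (d : ℤ)] at h2 ⊢
  simpa only [Int.natAbs_natCast] using h2

theorem count_aux {a C : ℕ} (ha : a ≠ 0) (hC : C ≠ 0) (i : ℕ) (hi : i < a) :
    ((Finset.range a).filter (fun j : ℕ => (a : ℤ) ∣ (C : ℤ) * ((i : ℤ) - j))).card ≤ 2 * C + 1 := by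
  have ha' : (0 : ℤ) < a := by exact_mod_cast Nat.pos_of_ne_zero ha
  have hC' : (0 : ℤ) < C := by exact_mod_cast Nat.pos_of_ne_zero hC
  have : (Finset.Icc (-(C : ℤ)) C).card = 2 * C + 1 := by simp; omega
  rw [← this]
  apply Finset.card_le_card_of_injOn (fun j : ℕ => ((C : ℤ) * ((i : ℤ) - j)) / a)
  · intro j hj
    simp only [Finset.coe_filter, Finset.mem_range, Set.mem_ofPred_eq] at hj
    obtain ⟨hj1, t, ht⟩ := hj
    simp only [Finset.coe_Icc, Set.mem_Icc]
    rw [ht, Int.mul_ediv_cancel_left _ ha'.ne']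
    have b1 : (i : ℤ) - j ≤ a := by omega
    have b2 : -(a : ℤ) ≤ (i : ℤ) - j := by omega
    constructor
    · nlinarith
    · nlinarith
  · intro j hj j' hj' h
    simp only [Finset.coe_filter, Finset.mem_range, Set.mem_ofPred_eq] at hj hj'
    obtain ⟨hj1, t, ht⟩ := hj
    obtain ⟨hj1', t', ht'⟩ := hj'
    simp only at h
    rw [ht, ht', Int.mul_ediv_cancel_left _ ha'.ne', Int.mul_ediv_cancel_left _ ha'.ne'] at h
    subst h
    have : (C : ℤ) * ((i : ℤ) - j) = C * ((i : ℤ) - j') := by rw [ht, ht']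
    have := mul_left_cancel₀ hC'.ne' this
    omega

theorem pairs_card {a C : ℕ} (ha : a ≠ 0) (hC : C ≠ 0) (m : ℕ → ℤ)
    (h : ∀ i j : ℕ, i < a → j < a → (a : ℤ) ∣ m i - m j → (a : ℤ) ∣ (C : ℤ) * ((i : ℤ) - j)) :
    (pairs a a m).card ≤ a * (2 * C + 1) := by
  have hsub : pairs a a m ⊆ ((Finset.range a).sigma (fun i =>
      (Finset.range a).filter (fun j : ℕ => (a : ℤ) ∣ (C : ℤ) * ((i : ℤ) - j)))).image
        (fun s => (s.1, s.2)) := by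
    rintro ⟨i, j⟩ hij
    simp only [pairs, Finset.mem_filter, Finset.mem_product, Finset.mem_range] at hij
    simp only [Finset.mem_image, Finset.mem_sigma, Finset.mem_filter, Finset.mem_range]
    exact ⟨⟨i, j⟩, ⟨hij.1.1, hij.1.2, h i j hij.1.1 hij.1.2 hij.2⟩, rfl⟩
  refine (Finset.card_le_card hsub).trans (Finset.card_image_le.trans ?_)
  rw [Finset.card_sigma]
  refine (Finset.sum_le_card_nsmul _ _ (2 * C + 1) ?_).trans ?_
  · intro i hi
    exact count_aux ha hC i (Finset.mem_range.mp hi)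
  · simp

theorem drop_coprime {p n : ℕ} {X Y : ℕ} (hX : Nat.Coprime X p) (hY : Nat.Coprime Y p) (k : ℤ)
    {L i d : ℕ} (h : i + d ≤ L)
    (hd : ((p : ℤ) ^ n) ∣ k * (X ^ (L - i) * Y ^ i) - k * (X ^ (L - (i + d)) * Y ^ (i + d))) :
    ((p : ℤ) ^ n) ∣ k * ((X : ℤ) ^ d - (Y : ℤ) ^ d) := by
  have e : k * ((X : ℤ) ^ (L - i) * Y ^ i) - k * (X ^ (L - (i + d)) * Y ^ (i + d)) =
      (X ^ (L - (i + d)) * Y ^ i) * (k * ((X : ℤ) ^ d - (Y : ℤ) ^ d)) := by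
    have : L - i = (L - (i + d)) + d := by omega
    rw [this, pow_add, pow_add]; ring
  rw [e] at hd
  have hc : IsCoprime ((p : ℤ) ^ n) ((X : ℤ) ^ (L - (i + d)) * Y ^ i) := by
    have h1 : IsCoprime (p : ℤ) (X : ℤ) := (Nat.isCoprime_iff_coprime.mpr hX).symm
    have h2 : IsCoprime (p : ℤ) (Y : ℤ) := (Nat.isCoprime_iff_coprime.mpr hY).symm
    exact (h1.pow_right.mul_right h2.pow_right).pow_left
  exact hc.dvd_of_dvd_mul_left hd

theorem pairs_bound {p : ℕ} (hp : p ≠ 0) {X Y : ℕ} (hXY : X ≠ Y)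
    (hX : Nat.Coprime X p) (hY : Nat.Coprime Y p) {k : ℤ} (hk : k ≠ 0) :
    ∃ B : ℝ, ∀ n : ℕ, ((p ^ n : ℕ) : ℝ) * (pairs (p ^ n) (p ^ n)
      (fun i => k * ((X : ℤ) ^ (p ^ n - i) * (Y : ℤ) ^ i))).card / ((p ^ n : ℕ) : ℝ) ^ 2 ≤ B := by
  obtain ⟨C, hC, hdiv⟩ := lte_aux hp hXY hX hY hk
  refine ⟨2 * C + 1, fun n => ?_⟩
  have ha : p ^ n ≠ 0 := pow_ne_zero _ hp
  have hlt : ∀ i j : ℕ, i ≤ j → j < p ^ n → ((p ^ n : ℕ) : ℤ) ∣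
      k * ((X : ℤ) ^ (p ^ n - i) * (Y : ℤ) ^ i) - k * ((X : ℤ) ^ (p ^ n - j) * (Y : ℤ) ^ j) →
      ((p ^ n : ℕ) : ℤ) ∣ (C : ℤ) * ((i : ℤ) - j) := by
    intro i j hij hj h
    obtain ⟨d, rfl⟩ := Nat.exists_eq_add_of_le hij
    push_cast at h ⊢
    have h1 := hdiv n d (drop_coprime hX hY k hj.le h)
    have : (C : ℤ) * ((i : ℤ) - (i + d)) = -(C * d) := by ring
    rw [this]
    exact (dvd_neg).mpr h1
  have hcard := pairs_card (C := C) ha hC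
    (fun i => k * ((X : ℤ) ^ (p ^ n - i) * (Y : ℤ) ^ i)) (by
    intro i j hi hj h
    rcases le_total i j with hij | hij
    · exact hlt i j hij hj h
    · have h' := hlt j i hij hi (by rw [← dvd_neg, neg_sub]; exact h)
      rw [← dvd_neg, ← mul_neg, neg_sub] at h'
      exact h')
  have ha' : (0 : ℝ) < ((p ^ n : ℕ) : ℝ) := by exact_mod_cast Nat.pos_of_ne_zero ha
  rw [div_le_iff₀ (by positivity)]
  have : ((pairs (p ^ n) (p ^ n)
      (fun i => k * ((X : ℤ) ^ (p ^ n - i) * (Y : ℤ) ^ i))).card : ℝ) ≤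
      ((p ^ n : ℕ) : ℝ) * (2 * C + 1) := by exact_mod_cast hcard
  nlinarith

/-- Growth hypothesis. -/
def Growth (S : Set ℕ) (α c : ℝ) (N₀ : ℕ) : Prop :=
  ∀ N : ℕ, N₀ ≤ N → c * (N : ℝ) ^ α ≤ ((S ∩ Set.Icc 1 N).ncard : ℝ)

theorem growth_of_liminf {S : Set ℕ} {α : ℝ} (h : 0 < atTop.liminf
      (fun N : ℕ => ((S ∩ Set.Icc 1 N).ncard : ℝ) / (N : ℝ) ^ α)) :
    ∃ c > 0, ∃ N₀, Growth S α c N₀ := by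
  rw [liminf_eq] at h
  have : ∃ c ∈ {a : ℝ | ∀ᶠ N : ℕ in atTop, a ≤ ((S ∩ Set.Icc 1 N).ncard : ℝ) / (N : ℝ) ^ α}, 0 < c := by
    by_contra hcon
    push Not at hcon
    exact absurd h (not_lt.mpr (Real.sSup_nonpos hcon))
  obtain ⟨c, hc, hc0⟩ := this
  obtain ⟨N₀, hN⟩ := eventually_atTop.mp hc
  refine ⟨c, hc0, max N₀ 1, fun N hN' => ?_⟩
  have h1 := hN N ((le_max_left _ _).trans hN')
  have h2 : (0 : ℝ) < N := by
    have := (le_max_right N₀ 1).trans hN'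
    exact_mod_cast this
  rwa [le_div_iff₀ (Real.rpow_pos_of_pos h2 α)] at h1

theorem exists_N {α c : ℝ} (hα : 0 < α) (hc : 0 < c) (d N₀ : ℕ) :
    ∃ N, N₀ ≤ N ∧ (((Nat.log 2 N + 1) ^ d : ℕ) : ℝ) < c * (N : ℝ) ^ α := by
  have hr : (1 : ℝ) < 2 ^ α := Real.one_lt_rpow one_lt_two hα
  have ht := tendsto_pow_const_div_const_pow_of_one_lt d hr
  have hr0 : (0 : ℝ) < 2 ^ α := by linarith
  have h1 : ∀ᶠ j : ℕ in atTop, (j : ℝ) ^ d / ((2 : ℝ) ^ α) ^ j < c / 2 ^ α :=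
    ht.eventually_lt_const (by positivity)
  obtain ⟨j, hj, hjN⟩ := (((tendsto_add_atTop_nat 1).eventually h1).and
    (eventually_ge_atTop N₀)).exists
  refine ⟨2 ^ j, hjN.trans (Nat.lt_two_pow_self).le, ?_⟩
  rw [Nat.log_pow (by norm_num)]
  rw [div_lt_div_iff₀ (by positivity) hr0, pow_succ ((2 : ℝ) ^ α), ← mul_assoc] at hj
  have h2 := lt_of_mul_lt_mul_right hj hr0.le
  push_cast at h2 ⊢
  have h3 : ((2 : ℝ) ^ j) ^ α = ((2 : ℝ) ^ α) ^ j := by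
    rw [← Real.rpow_natCast 2 j, ← Real.rpow_mul zero_le_two, mul_comm (j : ℝ) α,
      Real.rpow_mul zero_le_two, Real.rpow_natCast]
  rw [h3]
  exact h2

theorem exists_pair {S : Set ℕ} {α c : ℝ} (hα : 0 < α) (hc : 0 < c) {N₀ : ℕ}
    (hS : Growth S α c N₀) {p : ℕ} (hp : p ≠ 0) :
    ∃ P X Y : ℕ, P ≠ 0 ∧ X ≠ Y ∧ Nat.Coprime X p ∧ Nat.Coprime Y p ∧ P * X ∈ S ∧ P * Y ∈ S := by
  obtain ⟨N, hN, hlt⟩ := exists_N hα hc p.primeFactors.card N₀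
  have hfin : (S ∩ Set.Icc 1 N).Finite := (Set.finite_Icc 1 N).inter_of_right S
  set A := hfin.toFinset with hA
  set B : Finset (p.primeFactors → ℕ) := Fintype.piFinset (fun _ => Finset.range (Nat.log 2 N + 1))
    with hB
  have hcard : B.card < A.card := by
    have h1 : B.card = (Nat.log 2 N + 1) ^ p.primeFactors.card := by
      rw [hB, Fintype.card_piFinset]; simp
    have h2 : ((S ∩ Set.Icc 1 N).ncard : ℝ) = A.card := by
      rw [Set.ncard_eq_toFinset_card _ hfin]
    have h3 := lt_of_lt_of_le hlt (hS N hN)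
    rw [h2, ← h1] at h3
    exact_mod_cast h3
  obtain ⟨s, hs, t, ht, hst, heq⟩ := Finset.exists_ne_map_eq_of_card_lt_of_maps_to hcard
    (f := fun s => fun r : p.primeFactors => s.factorization r.1) (by
      intro s hs
      simp only [hA, Set.Finite.coe_toFinset, Set.mem_inter_iff, Set.mem_Icc] at hs
      rw [Finset.mem_coe, hB, Fintype.mem_piFinset]
      intro r
      have hr := Nat.prime_of_mem_primeFactors r.2
      rw [Finset.mem_range, Nat.lt_succ_iff]
      apply Nat.le_log_of_pow_le (by norm_num)
      calc 2 ^ s.factorization r.1 ≤ r.1 ^ s.factorization r.1 :=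
            Nat.pow_le_pow_left hr.two_le _
        _ ≤ s := Nat.ordProj_le r.1 (by omega)
        _ ≤ N := hs.2.2)
  simp only [hA, Set.Finite.mem_toFinset, Set.mem_inter_iff, Set.mem_Icc] at hs ht
  have hdv : ∀ u : ℕ, u ≠ 0 → ∃ X, u = (∏ r ∈ p.primeFactors, r ^ u.factorization r) * X ∧
      Nat.Coprime X p := by
    intro u hu
    have h1 : (∏ r ∈ p.primeFactors, r ^ u.factorization r) ∣ u := by
      apply Finset.prod_dvd_of_isRelPrime
      · intro r hr r' hr' hne
        have h1 := Nat.prime_of_mem_primeFactors hr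
        have h2 := Nat.prime_of_mem_primeFactors hr'
        exact Nat.coprime_iff_isRelPrime.mp (Nat.coprime_pow_primes _ _ h1 h2 hne)
      · intro r _
        exact Nat.ordProj_dvd u r
    obtain ⟨X, hX⟩ := h1
    refine ⟨X, hX, ?_⟩
    apply Nat.Coprime.symm
    rw [Nat.coprime_iff_gcd_eq_one]
    by_contra hne
    obtain ⟨r, hr, hrd⟩ := Nat.exists_prime_and_dvd hne
    have hrp : r ∣ p := hrd.trans (Nat.gcd_dvd_left _ _)
    have hrX : r ∣ X := hrd.trans (Nat.gcd_dvd_right _ _)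
    have hrm : r ∈ p.primeFactors := Nat.mem_primeFactors.mpr ⟨hr, hrp, hp⟩
    have h3 : r ^ (u.factorization r + 1) ∣ u := by
      conv_rhs => rw [hX]
      rw [pow_succ]
      exact mul_dvd_mul (Finset.dvd_prod_of_mem (fun r => r ^ u.factorization r) hrm) hrX
    exact Nat.pow_succ_factorization_not_dvd hu hr h3
  obtain ⟨X, hX, hXp⟩ := hdv s (by omega)
  obtain ⟨Y, hY, hYp⟩ := hdv t (by omega)
  have hPP : (∏ r ∈ p.primeFactors, r ^ s.factorization r) =
      ∏ r ∈ p.primeFactors, r ^ t.factorization r := by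
    apply Finset.prod_congr rfl
    intro r hr
    have := congrFun heq ⟨r, hr⟩
    simp only at this
    rw [this]
  rw [← hPP] at hY
  set P := ∏ r ∈ p.primeFactors, r ^ s.factorization r
  refine ⟨P, X, Y, ?_, ?_, hXp, hYp, ?_, ?_⟩
  · intro h; rw [h, zero_mul] at hX; omega
  · intro h; apply hst; rw [hX, hY, h]
  · rw [← hX]; exact hs.1
  · rw [← hY]; exact ht.1


theorem cont_int (μ : Measure Circ) [IsProbabilityMeasure μ] :
    Continuous (fun f : C(Circ, ℂ) => ∫ x, f x ∂μ) := by
  have : LipschitzWith 1 (fun f : C(Circ, ℂ) => ∫ x, f x ∂μ) := by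
    apply LipschitzWith.of_dist_le_mul
    intro f g
    have hf : Integrable f μ := f.continuous.integrable_of_hasCompactSupport
      (HasCompactSupport.of_compactSpace f)
    have hg : Integrable g μ := g.continuous.integrable_of_hasCompactSupport
      (HasCompactSupport.of_compactSpace g)
    rw [dist_eq_norm, ← integral_sub hf hg, NNReal.coe_one, one_mul]
    have := norm_integral_le_of_norm_le_const (μ := μ) (f := fun x => f x - g x) (C := dist f g)
      (Eventually.of_forall (fun x => by
        rw [← dist_eq_norm]; exact ContinuousMap.dist_apply_le_dist x))
    simpa using this
  exact this.continuous

theorem fourier_ext (μ ν : Measure Circ) [IsProbabilityMeasure μ] [IsProbabilityMeasure ν]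
    (h : ∀ k : ℤ, ∫ x : Circ, fourier k x ∂μ = ∫ x : Circ, fourier k x ∂ν) : μ = ν := by
  have hall : ∀ f : C(Circ, ℂ), ∫ x, f x ∂μ = ∫ x, f x ∂ν := by
    intro f
    have hf : f ∈ (Submodule.span ℂ (Set.range <| @fourier (1 : ℝ))).topologicalClosure := by
      rw [span_fourier_closure_eq_top]; trivial
    rw [← SetLike.mem_coe, Submodule.topologicalClosure_coe] at hf
    refine closure_minimal ?_ (isClosed_eq (cont_int μ) (cont_int ν)) hf
    intro g hg
    rw [SetLike.mem_coe] at hg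
    have hi : ∀ (ρ : Measure Circ) [IsProbabilityMeasure ρ] (f : C(Circ, ℂ)), Integrable f ρ := by
      intro ρ _ f
      exact f.continuous.integrable_of_hasCompactSupport
        (HasCompactSupport.of_compactSpace f)
    induction hg using Submodule.span_induction with
    | mem x hx => obtain ⟨k, rfl⟩ := hx; exact h k
    | zero => simp
    | add x y _ _ hx hy =>
      simp only [Set.mem_ofPred_eq, ContinuousMap.add_apply] at hx hy ⊢
      rw [integral_add (hi μ x) (hi μ y), integral_add (hi ν x) (hi ν y), hx, hy]
    | smul a x _ hx =>
      simp only [Set.mem_ofPred_eq, ContinuousMap.smul_apply] at hx ⊢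
      rw [integral_smul, integral_smul, hx]
  apply ext_of_forall_integral_eq_of_IsFiniteMeasure
  intro f
  have := hall ⟨fun x => (f x : ℂ), by fun_prop⟩
  simp only [ContinuousMap.coe_mk] at this
  rw [integral_complex_ofReal, integral_complex_ofReal] at this
  exact_mod_cast this

theorem int_fourier_vol {k : ℤ} (hk : k ≠ 0) : ∫ x : Circ, fourier k x = 0 :=
  integral_eq_zero_of_add_right_eq_neg (fourier_add_half_inv_index hk Fact.out)

theorem eq_volume (μ : Measure Circ) [IsProbabilityMeasure μ]
    (h : ∀ k : ℤ, k ≠ 0 → ∫ x : Circ, fourier k x ∂μ = 0) : μ = volume := by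
  have : IsProbabilityMeasure (volume : Measure Circ) := ⟨by simp⟩
  apply fourier_ext
  intro k
  by_cases hk : k = 0
  · subst hk; simp
  · rw [h k hk, int_fourier_vol hk]

/-- The ergodicity package used in the proof. -/
structure Sys (S : Set ℕ) (μ : Measure Circ) : Prop where
  mul : ∀ a ∈ S, ∀ b ∈ S, a * b ∈ S
  pos : ∀ a ∈ S, a ≠ 0
  ne : S.Nonempty
  inv : ∀ n ∈ S, μ.map (mulT n) = μ
  erg : ∀ A : Set Circ, MeasurableSet A → (∀ n ∈ S, mulT n ⁻¹' A = A) → μ A = 0 ∨ μ A = 1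

theorem Sys.pre {S : Set ℕ} {μ : Measure Circ} (h : Sys S μ) {n : ℕ} (hn : n ∈ S) {A : Set Circ}
    (hA : MeasurableSet A) : μ (mulT n ⁻¹' A) = μ A := by
  conv_rhs => rw [← h.inv n hn, Measure.map_apply (mulT_meas n) hA]

theorem Sys.zero_one {S : Set ℕ} {μ : Measure Circ} [IsProbabilityMeasure μ] (h : Sys S μ)
    {A : Set Circ} (hA : MeasurableSet A) (hsub : ∀ n ∈ S, ∀ᵐ x ∂μ, x ∈ A → mulT n x ∈ A) :
    μ A = 0 ∨ μ A = 1 := by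
  have hae : ∀ n ∈ S, ∀ᵐ x ∂μ, (mulT n x ∈ A ↔ x ∈ A) := by
    intro n hn
    have h1 : A ≤ᵐ[μ] mulT n ⁻¹' A := hsub n hn
    have h2 := ae_eq_of_ae_subset_of_measure_ge h1 (h.pre hn hA).le hA.nullMeasurableSet
      (measure_ne_top _ _)
    filter_upwards [h2] with x hx
    have : (A x) = (mulT n ⁻¹' A) x := hx
    exact (iff_of_eq this).symm
  set Z : Set Circ := ⋃ m ∈ S, ⋂ n ∈ S, mulT (m * n) ⁻¹' A with hZ
  have hZm : MeasurableSet Z := by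
    refine MeasurableSet.biUnion (Set.to_countable S) fun m _ =>
      MeasurableSet.biInter (Set.to_countable S) fun n _ => mulT_meas _ hA
  have hZinv : ∀ s ∈ S, mulT s ⁻¹' Z = Z := by
    intro s hs
    ext x
    simp only [hZ, Set.mem_preimage, Set.mem_iUnion, Set.mem_iInter, mulT_mulT, exists_prop]
    constructor
    · rintro ⟨m, hm, hx⟩
      refine ⟨m * s, h.mul _ hm _ hs, fun n hn => ?_⟩
      have := hx n hn
      rwa [show m * s * n = m * n * s by ring]
    · rintro ⟨m, hm, hx⟩
      refine ⟨m, hm, fun n hn => ?_⟩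
      have := hx (n * s) (h.mul _ hn _ hs)
      rwa [show m * n * s = m * (n * s) by ring]
  have hall : ∀ᵐ x ∂μ, ∀ n : ℕ, n ∈ S → (mulT n x ∈ A ↔ x ∈ A) := by
    rw [ae_all_iff]; intro n; by_cases hn : n ∈ S
    · filter_upwards [hae n hn] with x hx _ using hx
    · exact Eventually.of_forall (fun x h => absurd h hn)
  have hZA : Z =ᵐ[μ] A := by
    filter_upwards [hall] with x hx
    have : x ∈ Z ↔ x ∈ A := by
      simp only [hZ, Set.mem_preimage, Set.mem_iUnion, Set.mem_iInter, exists_prop]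
      constructor
      · rintro ⟨m, hm, hx'⟩
        obtain ⟨n, hn⟩ := h.ne
        exact (hx _ (h.mul _ hm _ hn)).mp (hx' n hn)
      · intro hxA
        obtain ⟨m, hm⟩ := h.ne
        exact ⟨m, hm, fun n hn => (hx _ (h.mul _ hm _ hn)).mpr hxA⟩
    exact propext this
  rw [← measure_congr hZA]
  exact h.erg Z hZm hZinv

theorem Sys.pow {S : Set ℕ} {μ : Measure Circ} (h : Sys S μ) {p : ℕ} (hp : p ∈ S) (n : ℕ)
    : μ.map (mulT (p ^ n)) = μ := by
  induction n with
  | zero =>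
    have : mulT (p ^ 0) = id := by ext x; simp [mulT]
    rw [this, Measure.map_id]
  | succ n ih =>
    rw [pow_succ', ← mulT_comp, ← Measure.map_map (mulT_meas _) (mulT_meas _), ih, h.inv p hp]

/-- The infimum of the information cocycle. -/
noncomputable def Phi (p : ℕ) (μ : Measure Circ) (x : Circ) : ℝ≥0∞ := ⨅ n : ℕ, phi (p ^ n) μ x

theorem Phi_meas (p : ℕ) (μ : Measure Circ) : Measurable (Phi p μ) :=
  Measurable.iInf fun n => phi_meas _ μ

theorem Sys.Phi_zero_one {S : Set ℕ} {μ : Measure Circ} [IsProbabilityMeasure μ] (h : Sys S μ)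
    {p : ℕ} (hp : p ∈ S) : μ {x | Phi p μ x = 0} = 0 ∨ μ {x | Phi p μ x = 0} = 1 := by
  have hp0 := h.pos p hp
  refine h.zero_one ((Phi_meas p μ) (measurableSet_singleton 0)) ?_
  intro s hs
  have hs0 := h.pos s hs
  have key : ∀ n : ℕ, ∀ᵐ x ∂μ, phi s μ x * phi (p ^ n) μ (mulT s x) ≤ phi (p ^ n) μ x := by
    intro n
    have h1 := phi_chain μ (pow_ne_zero n hp0) hs0
    have h2 := phi_chain μ hs0 (pow_ne_zero n hp0)
    rw [h.pow hp n] at h1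
    rw [h.inv s hs] at h2
    have h3 : ∀ᵐ x ∂μ, phi s μ (mulT (p ^ n) x) ≤ 1 := by
      apply ae_map_mulT (q := fun y => phi s μ y ≤ 1)
      rw [h.pow hp n]; exact phi_le_one μ hs0
    filter_upwards [h1, h2, h3] with x h1 h2 h3
    rw [← h2, mul_comm s, h1]
    exact mul_le_of_le_one_right' h3
  filter_upwards [ae_all_iff.mpr key, phi_pos μ hs0] with x hx hpos hxZ
  replace hxZ : Phi p μ x = 0 := hxZ
  change Phi p μ (mulT s x) = 0
  have : phi s μ x * Phi p μ (mulT s x) ≤ Phi p μ x := by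
    refine le_iInf fun n => ?_
    refine le_trans ?_ (hx n)
    gcongr
    exact iInf_le _ n
  rw [hxZ] at this
  have := le_antisymm this bot_le
  rcases mul_eq_zero.mp this with h' | h'
  · exact absurd h' hpos.ne'
  · exact h'

theorem Sys.int_fourier {S : Set ℕ} {μ : Measure Circ} (h : Sys S μ) {s : ℕ} (hs : s ∈ S) (k : ℤ) :
    ∫ x : Circ, fourier (k * s) x ∂μ = ∫ x : Circ, fourier k x ∂μ := by
  conv_rhs => rw [← h.inv s hs]
  rw [integral_map (mulT_meas s).aemeasurable (by fun_prop)]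
  simp only [fourier_mulT]

theorem Sys.pow_mem {S : Set ℕ} {μ : Measure Circ} (h : Sys S μ) {s t : ℕ} (hs : s ∈ S)
    (ht : t ∈ S) (a b : ℕ) : s ^ (a + 1) * t ^ b ∈ S := by
  have h1 : s ^ (a + 1) ∈ S := by
    induction a with
    | zero => simpa using hs
    | succ a ih => rw [_root_.pow_succ]; exact h.mul _ ih _ hs
  induction b with
  | zero => simpa using h1
  | succ b ih => rw [_root_.pow_succ t, ← mul_assoc]; exact h.mul _ ih _ ht

theorem Sys.lebesgue {S : Set ℕ} {μ : Measure Circ} [IsProbabilityMeasure μ] (h : Sys S μ)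
    {α c : ℝ} (hα : 0 < α) (hc : 0 < c) {N₀ : ℕ} (hS : Growth S α c N₀) {p : ℕ} (hp : p ∈ S)
    (hZ : μ {x | Phi p μ x = 0} = 1) : μ = volume := by
  have hp0 := h.pos p hp
  apply eq_volume
  intro k hk
  obtain ⟨P, X, Y, hP, hXY, hX, hY, hPX, hPY⟩ := exists_pair hα hc hS hp0
  obtain ⟨B, hB⟩ := pairs_bound hp0 hXY hX hY hk
  have hX0 : X ≠ 0 := fun h0 => h.pos _ hPX (by rw [h0, mul_zero])
  have main : ∀ (n : ℕ) (ε : ℝ≥0∞), ENNReal.ofReal (‖∫ x : Circ, fourier k x ∂μ‖ ^ 2) ≤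
      μ {x | ε < phi (p ^ n) μ x} + ε * ENNReal.ofReal B := by
    intro n ε
    have hL : p ^ n ≠ 0 := pow_ne_zero n hp0
    have := host μ (a := p ^ n) (Q := P ^ (p ^ n)) (c := X ^ (p ^ n)) (L := p ^ n) hL
      (pow_ne_zero _ hP) hL (Nat.Coprime.pow _ _ hX) (h.pow hp n)
      (by
        rw [← mul_pow, mul_comm]; exact h.pow hPX _) k
      (fun i => k * ((X : ℤ) ^ (p ^ n - i) * (Y : ℤ) ^ i)) (by
        intro i hi
        obtain ⟨j, hj⟩ : ∃ j, p ^ n - i = j + 1 := ⟨p ^ n - i - 1, by omega⟩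
        have hmem := h.pow_mem hPX hPY j i
        have := h.int_fourier hmem k
        rw [← this]
        congr 3
        have e : p ^ n = (j + 1) + i := by omega
        have e2 : P ^ (p ^ n) = P ^ (j + 1) * P ^ i := by rw [← pow_add, ← e]
        rw [hj, e2]
        push_cast
        ring_nf) ε
    refine this.trans ?_
    gcongr
    exact hB n
  have hanti : ∀ᵐ x ∂μ, ∀ n, phi (p ^ (n + 1)) μ x ≤ phi (p ^ n) μ x := by
    rw [ae_all_iff]; intro n
    have h1 := phi_chain μ (pow_ne_zero n hp0) hp0
    rw [h.pow hp n] at h1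
    have h3 : ∀ᵐ x ∂μ, phi p μ (mulT (p ^ n) x) ≤ 1 := by
      apply ae_map_mulT (q := fun y => phi p μ y ≤ 1)
      rw [h.pow hp n]; exact phi_le_one μ hp0
    filter_upwards [h1, h3] with x h1 h3
    rw [_root_.pow_succ, h1]
    exact mul_le_of_le_one_right' h3
  have hZ' : ∀ᵐ x ∂μ, Phi p μ x = 0 := by
    exact (prob_compl_eq_zero_iff (μ := μ) ((Phi_meas p μ) (measurableSet_singleton 0))).mpr hZ
  have hlim : ∀ ε : ℝ≥0∞, ε ≠ 0 → Tendsto (fun n => μ {x | ε < phi (p ^ n) μ x}) atTop (nhds 0) := by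
    intro ε hε
    have hm : ∀ n, MeasurableSet {x | ε < phi (p ^ n) μ x} := fun n =>
      measurableSet_lt measurable_const (phi_meas _ μ)
    have := tendsto_measure_of_ae_tendsto_indicator_of_isFiniteMeasure (μ := μ) atTop
      (A := ∅) (As := fun n => {x | ε < phi (p ^ n) μ x}) MeasurableSet.empty hm (by
        filter_upwards [hanti, hZ'] with x hx hx0
        have hanti' : Antitone (fun n => phi (p ^ n) μ x) := antitone_nat_of_succ_le hx
        have : Phi p μ x < ε := by rw [hx0]; exact pos_iff_ne_zero.mpr hε
        obtain ⟨n, hn⟩ := iInf_lt_iff.mp this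
        filter_upwards [eventually_ge_atTop n] with m hm
        simp only [Set.mem_empty_iff_false, iff_false, not_lt]
        exact (hanti' hm).trans hn.le)
    simpa using this
  have h0 : ENNReal.ofReal (‖∫ x : Circ, fourier k x ∂μ‖ ^ 2) ≤ 0 := by
    have step : ∀ ε : ℝ≥0∞, ε ≠ 0 → ENNReal.ofReal (‖∫ x : Circ, fourier k x ∂μ‖ ^ 2) ≤
        ε * ENNReal.ofReal B := by
      intro ε hε
      have := ge_of_tendsto' ((hlim ε hε).add_const (ε * ENNReal.ofReal B)) (fun n => main n ε)
      simpa using this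
    have ht : Tendsto (fun n : ℕ => ((n : ℝ≥0∞))⁻¹ * ENNReal.ofReal B) atTop (nhds 0) := by
      have := ENNReal.Tendsto.mul_const ENNReal.tendsto_inv_nat_nhds_zero
        (b := ENNReal.ofReal B) (Or.inr ENNReal.ofReal_ne_top)
      simpa using this
    exact ge_of_tendsto' ht (fun n => step _ (by simp))
  have h1 := ENNReal.ofReal_eq_zero.mp (le_antisymm h0 bot_le)
  have h2 : ‖∫ x : Circ, fourier k x ∂μ‖ ^ 2 = 0 := le_antisymm h1 (sq_nonneg _)
  simpa using h2

theorem Sys.phi_one {S : Set ℕ} {μ : Measure Circ} [IsProbabilityMeasure μ] (h : Sys S μ)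
    {p : ℕ} (hp : p ∈ S) (hZ : μ {x | Phi p μ x = 0} = 0) : ∀ᵐ x ∂μ, phi p μ x = 1 := by
  have hp0 := h.pos p hp
  have hle : ∀ᵐ x ∂μ, ∀ n, phi p μ x * phi (p ^ n) μ (mulT p x) = phi (p ^ (n + 1)) μ x := by
    rw [ae_all_iff]; intro n
    have h1 := phi_chain μ hp0 (pow_ne_zero n hp0)
    rw [h.inv p hp] at h1
    filter_upwards [h1] with x h1
    rw [pow_succ', h1]
  have h1 : ∀ᵐ x ∂μ, Phi p μ x ≤ phi p μ x * Phi p μ (mulT p x) := by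
    filter_upwards [hle, phi_le_one μ hp0, phi_pos μ hp0] with x hx hx1 hx0
    rw [Phi, Phi, ENNReal.mul_iInf_of_ne hx0.ne' (ne_top_of_le_ne_top ENNReal.one_ne_top hx1)]
    refine le_iInf fun n => ?_
    rw [hx n]; exact iInf_le _ _
  have hfin : ∀ᵐ x ∂μ, Phi p μ x ≤ 1 := by
    filter_upwards [phi_le_one μ (pow_ne_zero 0 hp0)] with x hx
    exact (iInf_le _ 0).trans hx
  have hPm := Phi_meas p μ
  have hPm' : Measurable (fun x => Phi p μ (mulT p x)) := hPm.comp (mulT_meas p)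
  have hInts : ∫⁻ x, Phi p μ (mulT p x) ∂μ = ∫⁻ x, Phi p μ x ∂μ := by
    rw [← lintegral_map hPm (mulT_meas p), h.inv p hp]
  have hfi : ∫⁻ x, Phi p μ x ∂μ ≠ ⊤ := by
    refine ne_top_of_le_ne_top ENNReal.one_ne_top ((lintegral_mono_ae hfin).trans ?_)
    simp
  have hle2 : (fun x => Phi p μ x) ≤ᵐ[μ] fun x => Phi p μ (mulT p x) := by
    filter_upwards [h1, phi_le_one μ hp0] with x hx hx1
    exact hx.trans (mul_le_of_le_one_left' hx1)
  have heq := ae_eq_of_ae_le_of_lintegral_le hle2 hfi hPm'.aemeasurable hInts.le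
  have hne : ∀ᵐ x ∂μ, Phi p μ x ≠ 0 := by rw [ae_iff]; simpa using hZ
  filter_upwards [h1, heq, hne, hfin, phi_le_one μ hp0] with x a1 a2 a3 a4 a5
  refine le_antisymm a5 ?_
  rw [← a2] at a1
  by_contra hlt
  push Not at hlt
  have : phi p μ x * Phi p μ x < 1 * Phi p μ x :=
    ENNReal.mul_lt_mul_left a3 (ne_top_of_le_ne_top ENNReal.one_ne_top a4) hlt
  rw [one_mul] at this
  exact absurd a1 (not_le.mpr this)

theorem Sys.inj_set {S : Set ℕ} {μ : Measure Circ} [IsProbabilityMeasure μ] (h : Sys S μ)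
    {p : ℕ} (hp : p ∈ S) (hone : ∀ᵐ x ∂μ, phi p μ x = 1) :
    ∃ E : Set Circ, MeasurableSet E ∧ μ E = 1 ∧ ∀ x ∈ E, ∀ y ∈ E, mulT p x = mulT p y → x = y := by
  have hp0 := h.pos p hp
  set E : Set Circ := {x | phi p μ x = 1} with hE
  have hEm : MeasurableSet E := (phi_meas p μ) (measurableSet_singleton 1)
  set ω := pull p (μ.map (mulT p)) with hω
  have hωE : ω E = 1 := by
    have h1 : μ E = 1 := prob_compl_eq_zero_iff hEm |>.mp (by rw [← mem_ae_iff]; exact hone)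
    rw [← phi_density μ hp0, withDensity_apply _ hEm] at h1
    rw [← h1, ← hω, ← setLIntegral_one]
    exact setLIntegral_congr_fun hEm (fun x hx => hx.symm)
  set f : Circ → ℝ≥0∞ := E.indicator 1 with hf
  have hfm : Measurable f := measurable_one.indicator hEm
  have hF : ∫⁻ x, fib p f (mulT p x) ∂μ = 1 := by
    rw [← lintegral_map (fib_meas hp0 hfm) (mulT_meas p), ← lintegral_pull hp0 _ hfm, ← hω, hf,
      lintegral_indicator_one hEm, hωE]
  have hge : ∀ᵐ x ∂μ, 1 ≤ fib p f (mulT p x) := by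
    filter_upwards [hone] with x hx
    have := le_fib p f x
    have hx' : x ∈ E := hx
    rwa [hf, Set.indicator_of_mem hx'] at this
  have heq := ae_eq_of_ae_le_of_lintegral_le (f := fun _ => 1) hge (by simp)
    ((fib_meas hp0 hfm).comp (mulT_meas p)).aemeasurable (by
      rw [hF]; simp)
  have hm2 : MeasurableSet {x | fib p f (mulT p x) ≤ 1} :=
    measurableSet_le ((fib_meas hp0 hfm).comp (mulT_meas p)) measurable_const
  refine ⟨E ∩ {x | fib p f (mulT p x) ≤ 1}, hEm.inter hm2, ?_, ?_⟩
  · rw [← prob_compl_eq_zero_iff (hEm.inter hm2), ← mem_ae_iff]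
    filter_upwards [hone, heq] with x hx1 hx2
    exact ⟨hx1, hx2.symm.le⟩
  · rintro x ⟨hx, hx2⟩ y ⟨hy, -⟩ hxy
    by_contra hne
    have : (2 : ℝ≥0∞) ≤ fib p f (mulT p x) := by
      unfold fib
      let u : {w // mulT p w = mulT p x} := ⟨x, rfl⟩
      let v : {w // mulT p w = mulT p x} := ⟨y, hxy.symm⟩
      have huv : u ≠ v := fun h => hne (congrArg Subtype.val h)
      have := ENNReal.sum_le_tsum (f := fun w : {w // mulT p w = mulT p x} => f w) {u, v}
      rw [Finset.sum_pair huv] at this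
      refine le_trans ?_ this
      simp only [u, v, hf, Set.indicator_of_mem hx, Set.indicator_of_mem hy]
      norm_num
    have := this.trans hx2
    norm_num at this


theorem mulT_coe (n : ℕ) (t : ℝ) : mulT n (t : Circ) = ((n * t : ℝ) : Circ) := by
  unfold mulT
  rw [← AddCircle.coe_nsmul, nsmul_eq_mul]

theorem mulT_sub (n : ℕ) (x y : Circ) : mulT n (x - y) = mulT n x - mulT n y := by
  unfold mulT; exact nsmul_sub _ _ _

theorem norm_rep (z : Circ) : ∃ t : ℝ, (t : Circ) = z ∧ ‖z‖ = |t| := by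
  refine ⟨lft z - round (lft z), ?_, ?_⟩
  · conv_rhs => rw [← lft_coe z]
    rw [coe_eq_iff]; exact ⟨-round (lft z), by push_cast; ring⟩
  · conv_lhs => rw [← lft_coe z]
    exact UnitAddCircle.norm_eq

theorem norm_coe_of_le {t : ℝ} (h : |t| ≤ 1 / 2) : ‖(t : Circ)‖ = |t| :=
  (AddCircle.norm_coe_eq_abs_iff (1 : ℝ) one_ne_zero).mpr (by simpa using h)

theorem norm_coe_le (t : ℝ) : ‖(t : Circ)‖ ≤ |t| := by
  rcases le_total |t| (1 / 2) with h | h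
  · rw [norm_coe_of_le h]
  · refine (AddCircle.norm_le_half_period (1 : ℝ) one_ne_zero).trans ?_
    simpa using h

theorem norm_mulT {p : ℕ} (hp : p ≠ 0) {z : Circ} (h : ‖z‖ < 1 / (2 * p)) :
    ‖mulT p z‖ = p * ‖z‖ := by
  obtain ⟨t, rfl, ht⟩ := norm_rep z
  have hp' : (0 : ℝ) < p := by exact_mod_cast Nat.pos_of_ne_zero hp
  rw [ht] at h ⊢
  rw [mulT_coe, norm_coe_of_le, abs_mul, abs_of_pos hp']
  rw [abs_mul, abs_of_pos hp']
  rw [lt_div_iff₀ (by positivity)] at h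
  linarith

theorem norm_mulT_le (p : ℕ) (z : Circ) : ‖mulT p z‖ ≤ p * ‖z‖ := by
  unfold mulT; exact norm_nsmul_le

theorem mulT_cont (n : ℕ) : Continuous (mulT n) := by
  unfold mulT; fun_prop

theorem unif_inj {p : ℕ} {K : Set Circ} (hK : IsCompact K)
    (hinj : ∀ x ∈ K, ∀ y ∈ K, mulT p x = mulT p y → x = y) {r : ℝ} (hr : 0 < r) :
    ∃ η > 0, ∀ x ∈ K, ∀ y ∈ K, ‖mulT p x - mulT p y‖ < η → ‖x - y‖ < r := by
  set C : Set (Circ × Circ) := (K ×ˢ K) ∩ {z | r ≤ ‖z.1 - z.2‖} with hC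
  have hCc : IsCompact C := (hK.prod hK).inter_right (isClosed_le continuous_const (by fun_prop))
  rcases C.eq_empty_or_nonempty with he | hne
  · refine ⟨1, one_pos, fun x hx y hy _ => ?_⟩
    by_contra hcon
    have : (x, y) ∈ C := ⟨⟨hx, hy⟩, not_lt.mp hcon⟩
    rw [he] at this; exact this
  · have hcont : Continuous (fun z : Circ × Circ => ‖mulT p z.1 - mulT p z.2‖) :=
      (((mulT_cont p).comp continuous_fst).sub ((mulT_cont p).comp continuous_snd)).norm
    obtain ⟨z, hz, hmin⟩ := hCc.exists_isMinOn hne hcont.continuousOn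
    refine ⟨‖mulT p z.1 - mulT p z.2‖, ?_, fun x hx y hy hlt => ?_⟩
    · rw [gt_iff_lt, norm_pos_iff, sub_ne_zero]
      intro h0
      have := hinj _ hz.1.1 _ hz.1.2 h0
      have h2 : r ≤ ‖z.1 - z.2‖ := hz.2
      rw [this, sub_self, norm_zero] at h2
      linarith
    · by_contra hcon
      have : (x, y) ∈ C := ⟨⟨hx, hy⟩, not_lt.mp hcon⟩
      exact absurd (hmin this) (not_le.mpr hlt)

/-- Running maxima of Birkhoff sums. -/
noncomputable def mx (T : Circ → Circ) (g : Circ → ℝ) : ℕ → Circ → ℝ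
  | 0 => fun _ => 0
  | n + 1 => fun x => max 0 (g x + mx T g n (T x))

theorem mx_nonneg (T : Circ → Circ) (g : Circ → ℝ) (n : ℕ) (x : Circ) : 0 ≤ mx T g n x := by
  cases n with
  | zero => exact le_rfl
  | succ n => exact le_max_left _ _

theorem mx_mono (T : Circ → Circ) (g : Circ → ℝ) (n : ℕ) (x : Circ) :
    mx T g n x ≤ mx T g (n + 1) x := by
  induction n generalizing x with
  | zero => exact mx_nonneg T g 1 x
  | succ n ih =>
    exact max_le_max le_rfl (add_le_add le_rfl (ih (T x)))

theorem le_mx (T : Circ → Circ) (g : Circ → ℝ) (n : ℕ) (x : Circ) :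
    ∑ i ∈ Finset.range n, g (T^[i] x) ≤ mx T g n x := by
  induction n generalizing x with
  | zero => exact le_rfl
  | succ n ih =>
    rw [Finset.sum_range_succ']
    refine le_trans ?_ (le_max_right _ _)
    have := ih (T x)
    simp only [Function.iterate_succ, Function.comp, Function.iterate_zero, id] at this ⊢
    linarith

theorem mx_meas {T : Circ → Circ} (hT : Measurable T) {g : Circ → ℝ} (hg : Measurable g) (n : ℕ) :
    Measurable (mx T g n) := by
  induction n with
  | zero => exact measurable_const
  | succ n ih => exact measurable_const.max (hg.add (ih.comp hT))

theorem mx_le {T : Circ → Circ} {g : Circ → ℝ} (hg : ∀ x, g x ≤ 1) (n : ℕ) (x : Circ) :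
    mx T g n x ≤ n := by
  induction n generalizing x with
  | zero => simp [mx]
  | succ n ih =>
    have := ih (T x)
    have h2 := hg x
    refine max_le (by positivity) ?_
    push_cast; linarith

theorem garsia (μ : Measure Circ) [IsProbabilityMeasure μ] {T : Circ → Circ} (hT : Measurable T)
    (hinv : μ.map T = μ) {g : Circ → ℝ} (hg : Measurable g) (hg1 : ∀ x, |g x| ≤ 1) (n : ℕ) :
    0 ≤ ∫ x in {x | 0 < mx T g n x}, g x ∂μ := by
  cases n with
  | zero => simp [mx]
  | succ n =>
    have hm := mx_meas hT hg
    have hi : ∀ k, Integrable (mx T g k) μ := fun k =>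
      Integrable.of_bound (hm k).aestronglyMeasurable k (Eventually.of_forall fun x => by
        rw [Real.norm_of_nonneg (mx_nonneg T g k x)]
        exact mx_le (fun x => (le_abs_self _).trans (hg1 x)) k x)
    have hgi : Integrable g μ := Integrable.of_bound hg.aestronglyMeasurable 1
      (Eventually.of_forall hg1)
    have hiT : Integrable (fun x => mx T g n (T x)) μ := by
      have h1 : Integrable (mx T g n) (μ.map T) := by rw [hinv]; exact hi n
      exact h1.comp_measurable hT
    have hintT : ∫ x, mx T g n (T x) ∂μ = ∫ x, mx T g n x ∂μ := by
      rw [← integral_map hT.aemeasurable (hm n).aestronglyMeasurable, hinv]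
    set A : Set Circ := {x | 0 < mx T g (n + 1) x} with hA
    have hAm : MeasurableSet A := measurableSet_lt measurable_const (hm _)
    have e1 : ∫ x in A, g x ∂μ = ∫ x in A, mx T g (n + 1) x ∂μ - ∫ x in A, mx T g n (T x) ∂μ := by
      rw [← integral_sub (hi _).integrableOn hiT.integrableOn]
      apply setIntegral_congr_fun hAm
      intro x hx
      have hx' : 0 < max 0 (g x + mx T g n (T x)) := hx
      have h3 : 0 < g x + mx T g n (T x) := by
        by_contra hcon
        rw [max_eq_left (not_lt.mp hcon)] at hx'
        exact lt_irrefl _ hx'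
      change g x = max 0 (g x + mx T g n (T x)) - mx T g n (T x)
      rw [max_eq_right h3.le]; ring
    have e2 : ∫ x in A, mx T g (n + 1) x ∂μ = ∫ x, mx T g (n + 1) x ∂μ := by
      apply setIntegral_eq_integral_of_forall_compl_eq_zero
      intro x hx
      exact le_antisymm (not_lt.mp hx) (mx_nonneg _ _ _ _)
    have e3 : ∫ x in A, mx T g n (T x) ∂μ ≤ ∫ x, mx T g n (T x) ∂μ :=
      setIntegral_le_integral hiT (Eventually.of_forall fun x => mx_nonneg _ _ _ _)
    have e4 : ∫ x, mx T g n x ∂μ ≤ ∫ x, mx T g (n + 1) x ∂μ :=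
      integral_mono (hi _) (hi _) (fun x => mx_mono T g n x)
    rw [e1, e2]; linarith

open Classical in
/-- Number of visits outside of `K` up to time `n`. -/
noncomputable def visits (T : Circ → Circ) (K : Set Circ) (n : ℕ) (x : Circ) : ℕ :=
  ((Finset.range n).filter (fun i => T^[i] x ∉ K)).card

theorem max_ineq (μ : Measure Circ) [IsProbabilityMeasure μ] {T : Circ → Circ} (hT : Measurable T)
    (hinv : μ.map T = μ) {K : Set Circ} (hK : MeasurableSet K) {D : ℕ} (hD : D ≠ 0) :
    μ {x | ∃ n, n < D * visits T K n x} ≤ D * μ Kᶜ := by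
  classical
  have hD' : (0 : ℝ) < D := by exact_mod_cast Nat.pos_of_ne_zero hD
  have hD1 : (1 : ℝ) ≤ D := by exact_mod_cast Nat.one_le_iff_ne_zero.mpr hD
  set g : Circ → ℝ := fun x => Kᶜ.indicator 1 x - 1 / D with hg
  have hgm : Measurable g := (measurable_one.indicator hK.compl).sub_const _
  have hd : 0 ≤ 1 / (D : ℝ) := by positivity
  have hd1 : 1 / (D : ℝ) ≤ 1 := by rw [div_le_one hD']; exact hD1
  have hg1 : ∀ x, |g x| ≤ 1 := by
    intro x
    rw [abs_le]
    by_cases hx : x ∈ Kᶜ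
    · simp only [hg, Set.indicator_of_mem hx, Pi.one_apply]; constructor <;> linarith
    · simp only [hg, Set.indicator_of_notMem hx]; constructor <;> linarith
  have hsum : ∀ n x, ∑ i ∈ Finset.range n, g (T^[i] x) = visits T K n x - n / D := by
    intro n x
    simp only [hg, Finset.sum_sub_distrib, Finset.sum_const, Finset.card_range, nsmul_eq_mul]
    congr 1
    · rw [visits, Finset.card_filter]
      push_cast
      apply Finset.sum_congr rfl
      intro i _
      simp [Set.indicator_apply]
    · ring
  have hsub : {x | ∃ n, n < D * visits T K n x} ⊆ ⋃ n, {x | 0 < mx T g n x} := by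
    rintro x ⟨n, hn⟩
    refine Set.mem_iUnion.mpr ⟨n, lt_of_lt_of_le ?_ (le_mx T g n x)⟩
    rw [hsum, sub_pos, div_lt_iff₀ hD']
    rw [mul_comm]; exact_mod_cast hn
  refine (measure_mono hsub).trans ?_
  have hmono : Monotone (fun n => {x | 0 < mx T g n x}) :=
    monotone_nat_of_le_succ fun n x hx => lt_of_lt_of_le hx (mx_mono T g n x)
  rw [hmono.measure_iUnion]
  refine iSup_le fun n => ?_
  have h0 := garsia μ hT hinv hgm hg1 n
  set A : Set Circ := {x | 0 < mx T g n x} with hA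
  have hAm : MeasurableSet A := measurableSet_lt measurable_const (mx_meas hT hgm n)
  have hi : Integrable (Kᶜ.indicator (1 : Circ → ℝ)) μ :=
    (integrable_const (1 : ℝ)).indicator hK.compl
  have h1 : ∫ x in A, g x ∂μ = μ.real (A ∩ Kᶜ) - 1 / D * μ.real A := by
    simp only [hg]
    rw [integral_sub hi.integrableOn (integrable_const _)]
    rw [integral_indicator_one hK.compl]
    simp [measureReal_restrict_apply, hK.compl, Set.inter_comm, mul_comm]
  rw [h1] at h0
  have h2 : μ.real (A ∩ Kᶜ) ≤ μ.real Kᶜ := measureReal_mono Set.inter_subset_right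
  have h3 : μ.real A ≤ D * μ.real Kᶜ := by
    have : 1 / D * μ.real A ≤ μ.real Kᶜ := by linarith
    rw [one_div, inv_mul_le_iff₀ hD'] at this
    exact this
  rw [← ofReal_measureReal (μ := μ) (s := A), ← ofReal_measureReal (μ := μ) (s := Kᶜ),
    ← ENNReal.ofReal_natCast, ← ENNReal.ofReal_mul (by positivity)]
  exact ENNReal.ofReal_le_ofReal h3


/-- Index of the arc of length `1/(m+1)` containing `x`. -/
noncomputable def arc (m : ℕ) (x : Circ) : Fin (m + 1) :=
  ⟨⌊((m : ℝ) + 1) * lft x⌋₊, by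
    have h0 := lft_nonneg x
    have h1 := lft_lt x
    rw [Nat.floor_lt (by positivity)]
    push_cast
    nlinarith⟩

theorem arc_close {m : ℕ} {x y : Circ} (h : arc m x = arc m y) : ‖x - y‖ < 1 / (m + 1) := by
  have h' : ⌊((m : ℝ) + 1) * lft x⌋₊ = ⌊((m : ℝ) + 1) * lft y⌋₊ := congrArg Fin.val h
  have hx := lft_nonneg x
  have hy := lft_nonneg y
  have a1 := Nat.floor_le (show 0 ≤ ((m : ℝ) + 1) * lft x by positivity)
  have a2 := Nat.lt_floor_add_one (((m : ℝ) + 1) * lft x)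
  have b1 := Nat.floor_le (show 0 ≤ ((m : ℝ) + 1) * lft y by positivity)
  have b2 := Nat.lt_floor_add_one (((m : ℝ) + 1) * lft y)
  rw [h'] at a1 a2
  have e : x - y = ((lft x - lft y : ℝ) : Circ) := by
    rw [AddCircle.coe_sub, lft_coe, lft_coe]
  rw [e]
  refine (norm_coe_le _).trans_lt ?_
  rw [lt_div_iff₀ (by positivity)]
  have : |lft x - lft y| * ((m : ℝ) + 1) = |(m + 1) * lft x - (m + 1) * lft y| := by
    rw [← mul_sub, abs_mul, abs_of_pos (show (0 : ℝ) < m + 1 by positivity), mul_comm]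
  rw [this, abs_lt]
  constructor <;> linarith

theorem code_bad (μ : Measure Circ) {ι : Type*} [Fintype ι] (C : Circ → ι) (W : ι → ℝ≥0∞)
    (hW : ∑ j, W j ≤ 1) (c : ℝ≥0∞) :
    μ {x | μ (C ⁻¹' {C x}) < c * W (C x)} ≤ c := by
  classical
  have hsub : {x | μ (C ⁻¹' {C x}) < c * W (C x)} ⊆
      ⋃ j : ι, (if μ (C ⁻¹' {j}) < c * W j then C ⁻¹' {j} else ∅) := by
    intro x hx
    refine Set.mem_iUnion.mpr ⟨C x, ?_⟩
    have hx' : μ (C ⁻¹' {C x}) < c * W (C x) := hx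
    rw [if_pos hx']
    rfl
  refine (measure_mono hsub).trans ((measure_iUnion_le _).trans ?_)
  rw [tsum_fintype]
  calc _ ≤ ∑ j, c * W j := by
        apply Finset.sum_le_sum
        intro j _
        split_ifs with hj
        · exact hj.le
        · simp
    _ = c * ∑ j, W j := by rw [Finset.mul_sum]
    _ ≤ c * 1 := by gcongr
    _ = c := mul_one c

theorem close_of_code {p : ℕ} (hp : p ≠ 0) {K : Set Circ} {η : ℝ}
    (hη : ∀ x ∈ K, ∀ y ∈ K, ‖mulT p x - mulT p y‖ < η → ‖x - y‖ < 1 / (2 * p)) (n : ℕ) :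
    ∀ x y : Circ, (∀ i < n, ‖(mulT p)^[i] x - (mulT p)^[i] y‖ < 1 / (2 * p) ∨
      ((mulT p)^[i] x ∈ K ∧ (mulT p)^[i] y ∈ K)) →
      ‖(mulT p)^[n] x - (mulT p)^[n] y‖ < η → ‖x - y‖ < η * (1 / p) ^ n := by
  have hp1 : (1 : ℝ) ≤ p := by exact_mod_cast Nat.one_le_iff_ne_zero.mpr hp
  have hp' : (0 : ℝ) < p := by linarith
  induction n with
  | zero => intro x y _ h; simpa using h
  | succ n ih =>
    intro x y h1 h2
    have h3 := ih (mulT p x) (mulT p y) (fun i hi => h1 (i + 1) (by omega)) h2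
    have hη0 : 0 ≤ η := (norm_nonneg _).trans h2.le
    have hlt : ‖mulT p x - mulT p y‖ < η := by
      refine h3.trans_le (mul_le_of_le_one_right hη0 (pow_le_one₀ (by positivity) ?_))
      rw [div_le_one hp']; exact hp1
    have h4 : ‖x - y‖ < 1 / (2 * p) := by
      rcases h1 0 (by omega) with h | h
      · exact h
      · exact hη x h.1 y h.2 hlt
    have h5 := norm_mulT hp h4
    rw [mulT_sub] at h5
    rw [h5] at h3
    rw [pow_succ, ← mul_assoc, mul_one_div, lt_div_iff₀ hp', mul_comm]
    exact h3

open Classical in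
/-- Symbol. -/
noncomputable def symb (p : ℕ) (K : Set Circ) (x : Circ) : Option (Fin (2 * p + 1)) :=
  if x ∈ K then none else some (arc (2 * p) x)

/-- Weight of a symbol. -/
noncomputable def wt (p : ℕ) (θ : ℝ) : Option (Fin (2 * p + 1)) → ℝ
  | none => θ
  | some _ => (1 - θ) / (2 * p + 1)

theorem wt_sum (p : ℕ) (θ : ℝ) : ∑ u, wt p θ u = 1 := by
  rw [Fintype.sum_option]
  simp only [wt, Finset.sum_const, Finset.card_univ, Fintype.card_fin, nsmul_eq_mul]
  have : (2 * (p : ℝ) + 1) ≠ 0 := by positivity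
  push_cast
  field_simp
  ring

theorem wt_nonneg (p : ℕ) {θ : ℝ} (h0 : 0 ≤ θ) (h1 : θ ≤ 1) (u) : 0 ≤ wt p θ u := by
  have : 0 ≤ 1 - θ := by linarith
  cases u with
  | none => exact h0
  | some _ => simp only [wt]; positivity

theorem prod_wt {p : ℕ} {K : Set Circ} {θ : ℝ} (h0 : 0 < θ) (h1 : θ < 1) {D n : ℕ}
    (hD : θ ^ D ≤ (1 - θ) / (2 * p + 1)) {T : Circ → Circ} {x : Circ}
    (hv : D * visits T K n x ≤ n) :
    θ ^ (2 * n) ≤ ∏ i : Fin n, wt p θ (symb p K (T^[i] x)) := by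
  classical
  rw [Fin.prod_univ_eq_prod_range (fun i => wt p θ (symb p K (T^[i] x))) n]
  have hρ0 : 0 < (1 - θ) / (2 * (p : ℝ) + 1) := div_pos (by linarith) (by positivity)
  have e : ∀ i, wt p θ (symb p K (T^[i] x)) =
      if T^[i] x ∈ K then θ else (1 - θ) / (2 * p + 1) := by
    intro i
    unfold symb
    split_ifs <;> rfl
  simp only [e]
  rw [Finset.prod_ite, Finset.prod_const, Finset.prod_const]
  have hcard : ((Finset.range n).filter (fun i => T^[i] x ∈ K)).card ≤ n := by
    simpa using Finset.card_filter_le (Finset.range n) (fun i => T^[i] x ∈ K)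
  have hvis : ((Finset.range n).filter (fun i => T^[i] x ∉ K)).card = visits T K n x := by
    unfold visits
    congr
  rw [hvis, two_mul, pow_add]
  apply mul_le_mul
  · exact pow_le_pow_of_le_one h0.le h1.le hcard
  · calc θ ^ n ≤ θ ^ (D * visits T K n x) := pow_le_pow_of_le_one h0.le h1.le hv
      _ = (θ ^ D) ^ visits T K n x := pow_mul _ _ _
      _ ≤ _ := pow_le_pow_left₀ (by positivity) hD _
  · positivity
  · positivity

/-- Code. -/
noncomputable def code (p N : ℕ) (K : Set Circ) (n : ℕ) (x : Circ) :
    (Fin n → Option (Fin (2 * p + 1))) × Fin (N + 1) :=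
  (fun i => symb p K ((mulT p)^[i] x), arc N ((mulT p)^[n] x))

theorem code_close {p N : ℕ} (hp : p ≠ 0) {K : Set Circ} {η : ℝ}
    (hη : ∀ x ∈ K, ∀ y ∈ K, ‖mulT p x - mulT p y‖ < η → ‖x - y‖ < 1 / (2 * p))
    (hN : 1 / ((N : ℝ) + 1) < η) (n : ℕ) {x y : Circ} (h : code p N K n x = code p N K n y) :
    ‖x - y‖ < η * (1 / p) ^ n := by
  have hp' : (0 : ℝ) < p := by exact_mod_cast Nat.pos_of_ne_zero hp
  obtain ⟨h1, h2⟩ := Prod.ext_iff.mp h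
  apply close_of_code hp hη n
  · intro i hi
    have h3 := congrFun h1 ⟨i, hi⟩
    simp only [code, symb] at h3
    split_ifs at h3 with hx hy hy
    · exact Or.inr ⟨hx, hy⟩
    · left
      have := arc_close (Option.some_injective _ h3)
      refine this.trans ?_
      push_cast
      apply one_div_lt_one_div_of_lt <;> linarith
  · exact (arc_close h2).trans hN

/-- Weight of a code. -/
noncomputable def cwt (p N : ℕ) (θ : ℝ) (n : ℕ) (u : (Fin n → Option (Fin (2 * p + 1))) × Fin (N + 1)) : ℝ :=
  (∏ i, wt p θ (u.1 i)) * (1 / ((N : ℝ) + 1))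

theorem cwt_sum (p N : ℕ) (θ : ℝ) (n : ℕ) : ∑ u, cwt p N θ n u = 1 := by
  classical
  unfold cwt
  rw [Fintype.sum_prod_type]
  simp only [Finset.sum_const, Finset.card_univ, Fintype.card_fin, nsmul_eq_mul]
  have hN : ((N : ℝ) + 1) ≠ 0 := by positivity
  have : ∀ t : ℝ, ((N + 1 : ℕ) : ℝ) * (t * (1 / ((N : ℝ) + 1))) = t := by
    intro t; push_cast; field_simp
  simp only [this]
  have h := Finset.prod_univ_sum (fun _ : Fin n => (Finset.univ : Finset (Option (Fin (2 * p + 1)))))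
    (fun _ u => wt p θ u)
  simp only [wt_sum, Finset.prod_const_one, Fintype.piFinset_univ] at h
  exact h.symm

theorem cwt_nonneg (p N : ℕ) {θ : ℝ} (h0 : 0 ≤ θ) (h1 : θ ≤ 1) (n : ℕ) (u) : 0 ≤ cwt p N θ n u := by
  unfold cwt
  exact mul_nonneg (Finset.prod_nonneg fun i _ => wt_nonneg p h0 h1 _) (by positivity)

theorem core (μ : Measure Circ) [IsProbabilityMeasure μ] {p : ℕ} (hp : p ≠ 0)
    (hinv : μ.map (mulT p) = μ) {E : Set Circ} (hEm : MeasurableSet E) (hE : μ E = 1)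
    (hinj : ∀ x ∈ E, ∀ y ∈ E, mulT p x = mulT p y → x = y) {θ : ℝ} (h0 : 0 < θ) (h1 : θ < 1) :
    ∃ G : Set Circ, 0 < μ G ∧ ∃ κ : ℝ, 0 < κ ∧ ∀ x ∈ G, ∀ n : ℕ,
      ENNReal.ofReal (κ * θ ^ (3 * n)) ≤ μ {y | ‖y - x‖ < (1 / p) ^ n} := by
  have hp' : (0 : ℝ) < p := by exact_mod_cast Nat.pos_of_ne_zero hp
  have hρ : 0 < (1 - θ) / (2 * (p : ℝ) + 1) := div_pos (by linarith) (by positivity)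
  obtain ⟨D', hD'⟩ := exists_pow_lt_of_lt_one hρ h1
  set D := D' + 1 with hDdef
  have hD : θ ^ D ≤ (1 - θ) / (2 * p + 1) :=
    (pow_le_pow_of_le_one h0.le h1.le (Nat.le_succ D')).trans hD'.le
  have hD0 : D ≠ 0 := by omega
  have hDinv : (1 / (4 * D) : ℝ≥0∞) ≠ 0 := by
    apply ENNReal.div_ne_zero.mpr
    exact ⟨one_ne_zero, ENNReal.mul_ne_top (by norm_num) (ENNReal.natCast_ne_top D)⟩
  obtain ⟨K, hKE, hKc, hKlt⟩ := hEm.exists_isCompact_sdiff_lt (measure_ne_top μ E) hDinv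
  have hKm : MeasurableSet K := hKc.measurableSet
  have hKcomp : μ Kᶜ ≤ 1 / (4 * D) := by
    have hEc : μ Eᶜ = 0 := (prob_compl_eq_zero_iff hEm).mpr hE
    have hsub : Kᶜ ⊆ (E \ K) ∪ Eᶜ := by
      intro x hx
      by_cases hxE : x ∈ E
      · exact Or.inl ⟨hxE, hx⟩
      · exact Or.inr hxE
    refine (measure_mono hsub).trans ((measure_union_le _ _).trans ?_)
    rw [hEc, add_zero]; exact hKlt.le
  obtain ⟨η', hη', hηK'⟩ := unif_inj (p := p) hKc
    (fun x hx y hy => hinj x (hKE hx) y (hKE hy)) (r := 1 / (2 * p)) (by positivity)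
  set η := min η' 1 with hηdef
  have hη : 0 < η := lt_min hη' one_pos
  have hη1 : η ≤ 1 := min_le_right _ _
  have hηK : ∀ x ∈ K, ∀ y ∈ K, ‖mulT p x - mulT p y‖ < η → ‖x - y‖ < 1 / (2 * p) :=
    fun x hx y hy h => hηK' x hx y hy (h.trans_le (min_le_left _ _))
  obtain ⟨N, hN⟩ := exists_nat_one_div_lt hη
  set κ₀ := (1 - θ) / 4 with hκ₀
  have hκ₀p : 0 < κ₀ := div_pos (by linarith) (by norm_num)
  set V := {x | ∃ n, n < D * visits (mulT p) K n x} with hV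
  have hVle : μ V ≤ 1 / 4 := by
    refine (max_ineq μ (mulT_meas p) hinv hKm hD0).trans ?_
    calc (D : ℝ≥0∞) * μ Kᶜ ≤ D * (1 / (4 * D)) := by gcongr
      _ = 1 / 4 := by
        have hd : (D : ℝ≥0∞) ≠ 0 := by exact_mod_cast hD0
        rw [one_div, one_div, ENNReal.mul_inv (Or.inl (by norm_num)) (Or.inl (by norm_num)),
          mul_left_comm, ENNReal.mul_inv_cancel hd (ENNReal.natCast_ne_top D), mul_one]
  set B : ℕ → Set Circ := fun n => {x | μ (code p N K n ⁻¹' {code p N K n x}) <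
    ENNReal.ofReal (κ₀ * θ ^ n) * ENNReal.ofReal (cwt p N θ n (code p N K n x))} with hB
  have hBle : ∀ n, μ (B n) ≤ ENNReal.ofReal (κ₀ * θ ^ n) := by
    intro n
    apply code_bad μ (code p N K n) (fun u => ENNReal.ofReal (cwt p N θ n u))
    rw [← ENNReal.ofReal_sum_of_nonneg (fun u _ => cwt_nonneg p N h0.le h1.le n u), cwt_sum]
    simp
  have hBU : μ (⋃ n, B n) ≤ 1 / 4 := by
    refine (measure_iUnion_le _).trans ((ENNReal.tsum_le_tsum hBle).trans ?_)
    have hs : Summable (fun n : ℕ => κ₀ * θ ^ n) :=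
      (summable_geometric_of_lt_one h0.le h1).mul_left κ₀
    rw [← ENNReal.ofReal_tsum_of_nonneg (fun n => by positivity) hs, tsum_mul_left,
      tsum_geometric_of_lt_one h0.le h1]
    have : κ₀ * (1 - θ)⁻¹ = 1 / 4 := by
      have : 1 - θ ≠ 0 := by linarith
      rw [hκ₀]; field_simp
    rw [this]
    rw [ENNReal.ofReal_div_of_pos (by norm_num)]
    simp
  refine ⟨(V ∪ ⋃ n, B n)ᶜ, ?_, κ₀ * (1 / ((N : ℝ) + 1)), by positivity, ?_⟩
  · by_contra hcon
    have hz : μ (V ∪ ⋃ n, B n)ᶜ = 0 := le_antisymm (not_lt.mp hcon) bot_le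
    have hu : (1 : ℝ≥0∞) ≤ 1 / 4 + 1 / 4 := by
      calc (1 : ℝ≥0∞) = μ Set.univ := measure_univ.symm
        _ = μ ((V ∪ ⋃ n, B n) ∪ (V ∪ ⋃ n, B n)ᶜ) := by rw [Set.union_compl_self]
        _ ≤ μ (V ∪ ⋃ n, B n) + μ (V ∪ ⋃ n, B n)ᶜ := measure_union_le _ _
        _ = μ (V ∪ ⋃ n, B n) := by rw [hz, add_zero]
        _ ≤ μ V + μ (⋃ n, B n) := measure_union_le _ _
        _ ≤ 1 / 4 + 1 / 4 := add_le_add hVle hBU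
    have h4 : (1 / 4 : ℝ≥0∞) = ENNReal.ofReal (1 / 4) := by
      rw [ENNReal.ofReal_div_of_pos (by norm_num)]; simp
    rw [h4, ← ENNReal.ofReal_add (by norm_num) (by norm_num), ENNReal.one_le_ofReal] at hu
    norm_num at hu
  · intro x hx n
    have hxV : x ∉ V := fun h => hx (Or.inl h)
    have hxB : x ∉ B n := fun h => hx (Or.inr (Set.mem_iUnion.mpr ⟨n, h⟩))
    have hv : D * visits (mulT p) K n x ≤ n := by
      by_contra hcon
      exact hxV ⟨n, not_le.mp hcon⟩
    have hge : ENNReal.ofReal (κ₀ * θ ^ n) * ENNReal.ofReal (cwt p N θ n (code p N K n x)) ≤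
        μ (code p N K n ⁻¹' {code p N K n x}) := by
      by_contra hcon
      exact hxB (not_le.mp hcon)
    have hprod := prod_wt (p := p) (K := K) h0 h1 hD hv
    refine le_trans ?_ (hge.trans (measure_mono ?_))
    · rw [← ENNReal.ofReal_mul (by positivity)]
      apply ENNReal.ofReal_le_ofReal
      have : κ₀ * (1 / ((N : ℝ) + 1)) * θ ^ (3 * n) =
          κ₀ * θ ^ n * (θ ^ (2 * n) * (1 / ((N : ℝ) + 1))) := by
        rw [show 3 * n = n + 2 * n by ring, pow_add]; ring
      rw [this]
      apply mul_le_mul_of_nonneg_left _ (by positivity)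
      exact mul_le_mul_of_nonneg_right hprod (by positivity)
    · intro y hy
      have hy' : code p N K n y = code p N K n x := hy
      have := code_close hp hηK hN n hy'
      refine this.trans_le ?_
      exact mul_le_of_le_one_left (by positivity) hη1


theorem torsion_of_approx {p : ℕ} (hp : 2 ≤ p) (x : Circ)
    (h : ∀ᶠ m : ℕ in atTop, ∃ q : ℕ, 1 ≤ q ∧ q ≤ p ^ m ∧ ‖mulT q x‖ < 2 * (1 / p) ^ (3 * m)) :
    ∃ q : ℕ, q ≠ 0 ∧ mulT q x = 0 := by
  have hp2 : (2 : ℝ) ≤ p := by exact_mod_cast hp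
  have hp0 : (0 : ℝ) < p := by linarith
  set X := lft x with hX
  have hu0 : (0 : ℝ) < 1 / p := by positivity
  have hu1 : (1 : ℝ) / p < 1 := by rw [div_lt_one hp0]; linarith
  have ht : Tendsto (fun m : ℕ => ((1 : ℝ) / p) ^ m) atTop (nhds 0) :=
    tendsto_pow_atTop_nhds_zero_of_lt_one hu0.le hu1
  have hsm : ∀ᶠ m : ℕ in atTop, ((1 : ℝ) / p) ^ m < 1 / (4 * p) :=
    ht.eventually_lt_const (by positivity)
  obtain ⟨m₁, hm₁⟩ := eventually_atTop.mp (h.and hsm)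
  choose! q hq1 hq2 hq3 using fun m hm => (hm₁ m hm).1
  set e : ℕ → ℤ := fun m => round (q m * X) with he
  set a : ℕ → ℝ := fun m => q m * X - e m with ha
  have hae : ∀ m, m₁ ≤ m → |a m| < 2 * (1 / p) ^ (3 * m) := by
    intro m hm
    have := hq3 m hm
    rw [← lft_coe x, mulT_coe, UnitAddCircle.norm_eq] at this
    exact this
  have hqR : ∀ m, m₁ ≤ m → (q m : ℝ) ≤ p ^ m := fun m hm => by exact_mod_cast hq2 m hm
  have hpu : ∀ m : ℕ, (p : ℝ) ^ m * (1 / p) ^ m = 1 := by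
    intro m; rw [← mul_pow, mul_one_div_cancel hp0.ne', one_pow]
  have hstep : ∀ m, m₁ ≤ m → (q (m + 1) : ℤ) * e m = q m * e (m + 1) := by
    intro m hm
    have hA := hae m hm
    have hB := hae (m + 1) (by omega)
    have hqa := hqR m hm
    have hqb := hqR (m + 1) (by omega)
    have hu := (hm₁ m hm).2
    set u := ((1 : ℝ) / p) ^ m with hudef
    have hupos : 0 < u := by positivity
    have hu1' : u ≤ 1 := pow_le_one₀ hu0.le hu1.le
    have e3 : ((1 : ℝ) / p) ^ (3 * m) = u * u * u := by rw [hudef]; ring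
    have e4 : ((1 : ℝ) / p) ^ (3 * (m + 1)) ≤ u * u * u := by
      rw [← e3]; exact pow_le_pow_of_le_one hu0.le hu1.le (by omega)
    have hR : |((q (m + 1) : ℝ) * e m - q m * e (m + 1))| < 1 := by
      have e1 : (q (m + 1) : ℝ) * e m - q m * e (m + 1) = q m * a (m + 1) - q (m + 1) * a m := by
        simp only [ha]; ring
      rw [e1]
      have b1 : |(q m : ℝ) * a (m + 1)| ≤ p ^ m * (2 * (u * u * u)) := by
        rw [abs_mul, abs_of_nonneg (Nat.cast_nonneg _)]
        exact mul_le_mul hqa (hB.le.trans (by linarith)) (abs_nonneg _) (by positivity)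
      have b2 : |(q (m + 1) : ℝ) * a m| ≤ p ^ (m + 1) * (2 * (u * u * u)) := by
        rw [abs_mul, abs_of_nonneg (Nat.cast_nonneg _)]
        exact mul_le_mul hqb (hA.le.trans (by linarith)) (abs_nonneg _) (by positivity)
      have c1 : (p : ℝ) ^ m * (2 * (u * u * u)) = 2 * (u * u) := by
        have := hpu m
        rw [← hudef] at this
        linear_combination 2 * u * u * this
      have c2 : (p : ℝ) ^ (m + 1) * (2 * (u * u * u)) = p * (2 * (u * u)) := by
        rw [pow_succ]; linear_combination p * c1
      have c3 : 4 * p * u < 1 := by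
        rw [lt_div_iff₀ (by positivity)] at hu; linarith
      have := abs_sub (q m * a (m + 1)) (q (m + 1) * a m)
      nlinarith [mul_pos hupos hupos, mul_pos hp0 (mul_pos hupos hupos)]
    have hZ : |((q (m + 1) : ℤ) * e m - q m * e (m + 1))| < 1 := by exact_mod_cast hR
    have := Int.abs_lt_one_iff.mp hZ
    linarith
  have hall : ∀ m, m₁ ≤ m → (q m₁ : ℤ) * e m = q m * e m₁ := by
    intro m hm
    induction m, hm using Nat.le_induction with
    | base => rfl
    | succ m hm ih =>
      have h1 := hstep m hm
      have hqm : (q m : ℤ) ≠ 0 := by have := hq1 m hm; omega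
      apply mul_left_cancel₀ hqm
      linear_combination (q (m + 1) : ℤ) * ih - (q m₁ : ℤ) * h1
  refine ⟨q m₁, by have := hq1 m₁ le_rfl; omega, ?_⟩
  have hbound : ∀ m, m₁ ≤ m → |a m₁| ≤ q m₁ * (2 * (1 / p) ^ m) := by
    intro m hm
    have h1 : (q m₁ : ℝ) * e m = q m * e m₁ := by exact_mod_cast hall m hm
    have h2 : (q m : ℝ) * a m₁ = q m₁ * a m := by
      simp only [ha]; linear_combination h1
    have hq : (1 : ℝ) ≤ q m := by exact_mod_cast hq1 m hm
    calc |a m₁| ≤ q m * |a m₁| := le_mul_of_one_le_left (abs_nonneg _) hq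
      _ = q m₁ * |a m| := by
        have := congrArg abs h2
        rwa [abs_mul, abs_mul, Nat.abs_cast, Nat.abs_cast] at this
      _ ≤ q m₁ * (2 * (1 / p) ^ m) := by
        apply mul_le_mul_of_nonneg_left _ (Nat.cast_nonneg _)
        refine (hae m hm).le.trans ?_
        apply mul_le_mul_of_nonneg_left _ (by norm_num)
        exact pow_le_pow_of_le_one hu0.le hu1.le (by omega)
  have h0 : |a m₁| ≤ 0 := by
    have ht2 : Tendsto (fun m : ℕ => (q m₁ : ℝ) * (2 * (1 / p) ^ m)) atTop (nhds 0) := by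
      have := (ht.const_mul 2).const_mul (q m₁ : ℝ)
      simpa using this
    exact ge_of_tendsto ht2 (eventually_atTop.mpr ⟨m₁, hbound⟩)
  have h1 : a m₁ = 0 := abs_eq_zero.mp (le_antisymm h0 (abs_nonneg _))
  rw [← lft_coe x, mulT_coe]
  have h2 : (q m₁ : ℝ) * lft x = e m₁ := by
    have : a m₁ = q m₁ * X - e m₁ := rfl
    rw [h1] at this; linarith
  rw [h2, AddCircle.coe_eq_zero_iff]
  exact ⟨e m₁, by simp⟩

theorem Sys.spread {S : Set ℕ} {μ : Measure Circ} (h : Sys S μ) {s M : ℕ} (hs : s ∈ S)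
    (hsM : s ≤ M) (x : Circ) (r : ℝ) (hr : 0 < r) :
    μ {y | ‖y - x‖ < r} ≤ μ {z | ‖z - mulT s x‖ < M * r} := by
  have hm : MeasurableSet {z : Circ | ‖z - mulT s x‖ < M * r} :=
    (isOpen_lt (by fun_prop) continuous_const).measurableSet
  rw [← h.pre hs hm]
  apply measure_mono
  intro y hy
  have hy' : ‖y - x‖ < r := hy
  change ‖mulT s y - mulT s x‖ < M * r
  rw [← mulT_sub]
  have hs0 : (0 : ℝ) < s := by exact_mod_cast Nat.pos_of_ne_zero (h.pos s hs)
  calc ‖mulT s (y - x)‖ ≤ s * ‖y - x‖ := norm_mulT_le _ _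
    _ < s * r := by gcongr
    _ ≤ M * r := by gcongr

theorem Sys.pigeon {S : Set ℕ} {μ : Measure Circ} [IsProbabilityMeasure μ] (h : Sys S μ)
    {M : ℕ} {x : Circ} {r b : ℝ} (hr : 0 < r) (hb0 : 0 ≤ b)
    (hb : ENNReal.ofReal b ≤ μ {y | ‖y - x‖ < r})
    (hlt : 1 < ((S ∩ Set.Icc 1 M).ncard : ℝ) * b) :
    ∃ q : ℕ, 1 ≤ q ∧ q ≤ M ∧ ‖mulT q x‖ < 2 * (M * r) := by
  have hfin : (S ∩ Set.Icc 1 M).Finite := (Set.finite_Icc 1 M).inter_of_right S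
  set A := hfin.toFinset with hA
  have hcard : ((S ∩ Set.Icc 1 M).ncard : ℝ) = A.card := by
    rw [Set.ncard_eq_toFinset_card _ hfin]
  rw [hcard] at hlt
  set B : ℕ → Set Circ := fun s => {z | ‖z - mulT s x‖ < M * r} with hB
  have hBm : ∀ s, MeasurableSet (B s) := fun s =>
    (isOpen_lt (by fun_prop) continuous_const).measurableSet
  have hex : ∃ s ∈ A, ∃ t ∈ A, t < s ∧ ‖mulT s x - mulT t x‖ < 2 * (M * r) := by
    by_contra hcon
    push Not at hcon
    have hdis : (A : Set ℕ).PairwiseDisjoint B := by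
      intro s hs t ht hst
      rw [Function.onFun, Set.disjoint_left]
      intro z hz1 hz2
      have hz1' : ‖z - mulT s x‖ < M * r := hz1
      have hz2' : ‖z - mulT t x‖ < M * r := hz2
      have h1 : ‖mulT s x - mulT t x‖ < 2 * (M * r) := by
        have : mulT s x - mulT t x = (z - mulT t x) - (z - mulT s x) := by abel
        rw [this]
        refine (norm_sub_le _ _).trans_lt ?_
        linarith
      rcases lt_or_gt_of_ne hst with hlt' | hlt'
      · have := hcon t ht s hs hlt'
        rw [norm_sub_rev] at this
        linarith
      · have := hcon s hs t ht hlt'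
        linarith
    have h1 := measure_biUnion_finset (μ := μ) hdis (fun s _ => hBm s)
    have h2 : μ (⋃ s ∈ A, B s) ≤ 1 := prob_le_one
    rw [h1] at h2
    have h3 : A.card • ENNReal.ofReal b ≤ ∑ s ∈ A, μ (B s) := by
      apply Finset.card_nsmul_le_sum
      intro s hs
      simp only [hA, Set.Finite.mem_toFinset, Set.mem_inter_iff, Set.mem_Icc] at hs
      exact hb.trans (h.spread hs.1 hs.2.2 x r hr)
    have h4 := h3.trans h2
    rw [nsmul_eq_mul, ← ENNReal.ofReal_natCast, ← ENNReal.ofReal_mul (by positivity),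
      ENNReal.ofReal_le_one] at h4
    linarith
  obtain ⟨s, hs, t, ht, hts, hn⟩ := hex
  simp only [hA, Set.Finite.mem_toFinset, Set.mem_inter_iff, Set.mem_Icc] at hs ht
  refine ⟨s - t, by omega, by omega, ?_⟩
  have : mulT (s - t) x = mulT s x - mulT t x := by
    rw [eq_sub_iff_add_eq]
    unfold mulT
    rw [← add_nsmul]; congr 1; omega
  rw [this]; exact hn

theorem tors_finite {q : ℕ} (hq : q ≠ 0) : {x : Circ | mulT q x = 0}.Finite := by
  refine ((Finset.range q).finite_toSet.image (fun j => br q j 0)).subset ?_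
  intro x hx
  obtain ⟨j, hj, hjx⟩ := exists_br hq x
  have hx' : mulT q x = 0 := hx
  rw [hx'] at hjx
  exact ⟨j, by simpa using hj, hjx⟩

theorem tors_countable : {x : Circ | ∃ q : ℕ, q ≠ 0 ∧ mulT q x = 0}.Countable := by
  have : {x : Circ | ∃ q : ℕ, q ≠ 0 ∧ mulT q x = 0} =
      ⋃ q ∈ {q : ℕ | q ≠ 0}, {x : Circ | mulT q x = 0} := by
    ext x; simp
  rw [this]
  exact Set.Countable.biUnion (Set.to_countable _) fun q hq => (tors_finite hq).countable

theorem Sys.atom {S : Set ℕ} {μ : Measure Circ} [IsProbabilityMeasure μ] (h : Sys S μ)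
    {α c : ℝ} (hα : 0 < α) (hc : 0 < c) {N₀ : ℕ} (hS : Growth S α c N₀) {p : ℕ} (hp : p ∈ S)
    (hp2 : 2 ≤ p) (hone : ∀ᵐ x ∂μ, phi p μ x = 1) : ∃ x, μ {x} ≠ 0 := by
  obtain ⟨E, hEm, hE, hinj⟩ := h.inj_set hp hone
  have hp1 : (1 : ℝ) < p := by exact_mod_cast hp2
  have hp0 : (0 : ℝ) < p := by linarith
  set θ : ℝ := (p : ℝ) ^ (-(α / 24)) with hθ
  have hθ0 : 0 < θ := Real.rpow_pos_of_pos hp0 _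
  have hθ1 : θ < 1 := Real.rpow_lt_one_of_one_lt_of_neg hp1 (by linarith)
  have hθα : 1 < θ ^ 12 * (p : ℝ) ^ α := by
    rw [hθ, ← Real.rpow_natCast, ← Real.rpow_mul hp0.le, ← Real.rpow_add hp0]
    apply Real.one_lt_rpow hp1
    push_cast; linarith
  obtain ⟨G, hG, κ, hκ, hGκ⟩ := core μ (h.pos p hp) (h.inv p hp) hEm hE hinj hθ0 hθ1
  have hsub : G ⊆ {x : Circ | ∃ q : ℕ, q ≠ 0 ∧ mulT q x = 0} := by
    intro x hx
    apply torsion_of_approx hp2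
    have h1 : ∀ᶠ m : ℕ in atTop, 1 / (c * κ) < (θ ^ 12 * (p : ℝ) ^ α) ^ m :=
      (tendsto_pow_atTop_atTop_of_one_lt hθα).eventually_gt_atTop _
    filter_upwards [h1, eventually_ge_atTop N₀] with m hm hmN
    have hMN : N₀ ≤ p ^ m := hmN.trans (Nat.lt_pow_self (by omega)).le
    have hgr := hS (p ^ m) hMN
    have key := h.pigeon (M := p ^ m) (x := x) (r := (1 / p) ^ (4 * m))
      (b := κ * θ ^ (3 * (4 * m))) (by positivity) (by positivity) (hGκ x hx (4 * m)) (by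
        have e1 : (((p ^ m : ℕ) : ℝ)) ^ α = ((p : ℝ) ^ α) ^ m := by
          push_cast
          rw [← Real.rpow_natCast (p : ℝ) m, ← Real.rpow_mul hp0.le, mul_comm (m : ℝ) α,
            Real.rpow_mul hp0.le, Real.rpow_natCast]
        have e2 : θ ^ (3 * (4 * m)) = (θ ^ 12) ^ m := by rw [← pow_mul]; congr 1; ring
        rw [e1] at hgr
        rw [e2]
        rw [div_lt_iff₀ (by positivity), mul_pow] at hm
        calc (1 : ℝ) < (θ ^ 12) ^ m * ((p : ℝ) ^ α) ^ m * (c * κ) := hm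
          _ = c * ((p : ℝ) ^ α) ^ m * (κ * (θ ^ 12) ^ m) := by ring
          _ ≤ _ := by gcongr)
    obtain ⟨q, hq1, hq2, hq3⟩ := key
    refine ⟨q, hq1, hq2, hq3.trans_eq ?_⟩
    have : (p : ℝ) ^ m * (1 / p) ^ m = 1 := by
      rw [← mul_pow, mul_one_div_cancel hp0.ne', one_pow]
    push_cast
    rw [show 4 * m = m + 3 * m by ring, pow_add]
    linear_combination 2 * (1 / (p : ℝ)) ^ (3 * m) * this
  by_contra hcon
  push Not at hcon
  have hcount : G.Countable := tors_countable.mono hsub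
  have : μ G = 0 := by
    rw [← Set.biUnion_of_singleton G]
    exact (measure_biUnion_null_iff hcount).mpr fun x _ => hcon x
  exact hG.ne' this

theorem Sys.finite_of_atom {S : Set ℕ} {μ : Measure Circ} [IsProbabilityMeasure μ] (h : Sys S μ)
    {x₀ : Circ} (hx : μ {x₀} ≠ 0) : ∃ F : Set Circ, F.Finite ∧ μ F = 1 := by
  set F : Set Circ := {x | μ {x₀} ≤ μ {x}} with hF
  have hfin : F.Finite := by
    have := Measure.finite_const_le_meas_of_disjoint_iUnion (μ := μ) (ε := μ {x₀})
      (pos_iff_ne_zero.mpr hx) (As := fun x : Circ => ({x} : Set Circ))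
      (fun x => measurableSet_singleton x) (fun x y hxy => by simpa [Function.onFun] using hxy)
      (measure_ne_top _ _)
    exact this
  refine ⟨F, hfin, ?_⟩
  have := h.zero_one hfin.measurableSet (by
    intro n hn
    refine Eventually.of_forall fun x hx => ?_
    have hx' : μ {x₀} ≤ μ {x} := hx
    change μ {x₀} ≤ μ {mulT n x}
    rw [← h.pre hn (measurableSet_singleton (mulT n x))]
    refine hx'.trans (measure_mono ?_)
    intro y hy
    rw [Set.mem_singleton_iff.mp hy]
    exact Set.mem_singleton _)
  rcases this with h0 | h1
  · exfalso
    apply hx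
    refine le_antisymm ?_ bot_le
    rw [← h0]
    apply measure_mono
    intro y hy
    rw [Set.mem_singleton_iff.mp hy]
    exact (le_rfl : μ {x₀} ≤ μ {x₀})
  · exact h1

theorem exists_two_le {S : Set ℕ} {α c : ℝ} (hα : 0 < α) (hc : 0 < c) {N₀ : ℕ}
    (hS : Growth S α c N₀) : ∃ p ∈ S, 2 ≤ p := by
  obtain ⟨P, X, Y, hP, hXY, hX, hY, hPX, hPY⟩ := exists_pair hα hc hS (p := 2) (by norm_num)
  have hX0 : X ≠ 0 := by intro h0; subst h0; norm_num at hX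
  have hY0 : Y ≠ 0 := by intro h0; subst h0; norm_num at hY
  have hP1 : 1 ≤ P := Nat.one_le_iff_ne_zero.mpr hP
  rcases le_or_gt 2 X with h | h
  · exact ⟨P * X, hPX, by nlinarith⟩
  · refine ⟨P * Y, hPY, ?_⟩
    have : 2 ≤ Y := by omega
    nlinarith

theorem stmt8 (α : ℝ) (hα : 0 < α) (S : Set ℕ) (hS : ∀ a ∈ S, ∀ b ∈ S, a * b ∈ S)
    (hgrowth : 0 < atTop.liminf
      (fun N : ℕ => ((S ∩ Set.Icc 1 N).ncard : ℝ) / (N : ℝ) ^ α))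
    (μ : Measure (AddCircle (1:ℝ))) [IsProbabilityMeasure μ]
    (hinv : ∀ n ∈ S, ∀ A : Set (AddCircle (1:ℝ)), MeasurableSet A →
      μ ((fun x : AddCircle (1:ℝ) => n • x) ⁻¹' A) = μ A)
    (herg : ∀ A : Set (AddCircle (1:ℝ)), MeasurableSet A →
      (∀ n ∈ S, (fun x : AddCircle (1:ℝ) => n • x) ⁻¹' A = A) → μ A = 0 ∨ μ A = 1) :
    (∃ F : Set (AddCircle (1:ℝ)), F.Finite ∧ μ F = 1) ∨ μ = volume := by
  by_cases h0 : 0 ∈ S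
  · left
    refine ⟨{0}, Set.finite_singleton 0, ?_⟩
    rw [← hinv 0 h0 {0} (measurableSet_singleton 0)]
    have : (fun x : AddCircle (1:ℝ) => 0 • x) ⁻¹' {0} = Set.univ := by
      ext x; simp
    rw [this, measure_univ]
  obtain ⟨c, hc, N₀, hG⟩ := growth_of_liminf hgrowth
  obtain ⟨p, hp, hp2⟩ := exists_two_le hα hc hG
  have h : Sys S μ :=
    { mul := hS
      pos := fun a ha h => h0 (h ▸ ha)
      ne := ⟨p, hp⟩
      inv := fun n hn => by
        ext A hA
        rw [Measure.map_apply (mulT_meas n) hA]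
        exact hinv n hn A hA
      erg := herg }
  rcases h.Phi_zero_one hp with hZ | hZ
  · left
    obtain ⟨x, hx⟩ := h.atom hα hc hG hp hp2 (h.phi_one hp hZ)
    exact h.finite_of_atom hx
  · right
    exact h.lebesgue hα hc hG hp hZ
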